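/- arXiv:2310.16404 — 2 statements merged into one kernel-verified Lean document; each statement's English description precedes it below -/
import Mathlib

section
/- (Corollary: optimal parameter choice for Algorithm 1.) Under the Problem setup, let {(x_k, y_k, λ_k, u_k, v_k)}_{k≥1} satisfy Scheme A with λ̂_{k+1} = λ_{k+1}, and let (x*, y*, λ*) ∈ Ω. Assume t_1 > max{1, √(2 L_{g2}/μ_g)}, α ≤ 1/L_{f2}, β ∈ ((1/μ_g)·(1 + 1/t_1), t_1²/L_{g2}], γ < (t_1·(β·μ_g − 1) − 1)/((t_1 + 1)·β·‖B‖²), and {t_k}_{k≥1} is nondecreasing with t_{k+1}² ≤ t_k² + t_{k+1}. Then for all k ≥ 1: 𝓛(x_k, y_k, λ*) − 𝓛(x*, y*, λ*) ≤ (E_1 + (γ·t_2²/2)·‖B(y_1 − y*)‖²)/t_k², ‖A x_k + B y_k − b‖ ≤ C_1/t_k², and |f(x_k) + g(y_k) − f(x*) − g(y*)| ≤ (E_1 + (γ·t_2²/2)·‖B(y_1 − y*)‖² + C_1·‖λ*‖)/t_k². Moreover, if t_{k+1} = (1 + √(1 + 4 t_k²))/2 for all k ≥ 1, then the right-hand sides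 may be replaced by 4·(E_1 + (γ·t_2²/2)·‖B(y_1 − y*)‖²)/(k+1)², 4·C_1/(k+1)², and 4·(E_1 + (γ·t_2²/2)·‖B(y_1 − y*)‖² + C_1·‖λ*‖)/(k+1)², respectively. -/
set_option autoImplicit false

open RealInnerProductSpace

/-- The Lagrangian `𝓛(x,y,λ) = f1 x + f2 x + g1 y + g2 y + ⟪λ, Ax + By − b⟫`. -/
noncomputable def Lagr {m n p : ℕ}
    (f1 f2 : EuclideanSpace ℝ (Fin m) → ℝ)
    (g1 g2 : EuclideanSpace ℝ (Fin n) → ℝ)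
    (A : EuclideanSpace ℝ (Fin m) →L[ℝ] EuclideanSpace ℝ (Fin p))
    (B : EuclideanSpace ℝ (Fin n) →L[ℝ] EuclideanSpace ℝ (Fin p))
    (b : EuclideanSpace ℝ (Fin p))
    (x : EuclideanSpace ℝ (Fin m)) (y : EuclideanSpace ℝ (Fin n))
    (l : EuclideanSpace ℝ (Fin p)) : ℝ :=
  f1 x + f2 x + g1 y + g2 y + ⟪l, A x + B y - b⟫

/-- A step of the recurrence `T'² ≤ T² + T'` grows by at most `1/2 + 1/(8T)`. -/
lemma growth_le {T T' : ℝ} (hT : 1 ≤ T) (hT' : T' ^ 2 ≤ T ^ 2 + T') :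
    T' ≤ T + 1 / 2 + 1 / (8 * T) := by
  by_contra! h
  have hx : 0 < 1 / (8 * T) := by positivity
  have h1 : 1 / (8 * T) * T = 1 / 8 := by field_simp
  nlinarith

lemma slack_le_sub_increment {τ T T' ϑ : ℝ} (hτ : 1 ≤ τ) (hT : 1 ≤ T) (hTT : T ≤ T')
    (hT' : T' ^ 2 ≤ T ^ 2 + T') (hϑ : ϑ * (τ + 1) ≤ τ) (hϑ0 : 0 ≤ ϑ) :
    (T - τ / 2 - τ / (8 * T)) / (τ + 1) ≤ T - (T' ^ 2 - T ^ 2) * ϑ := by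
  have h := growth_le hT hT'
  rw [div_le_iff₀ (by linarith)]
  have h2 : τ / (8 * T) = τ * (1 / (8 * T)) := by ring
  have h1 : (T' ^ 2 - T ^ 2) * (ϑ * (τ + 1)) ≤ T' * τ := by
    apply mul_le_mul <;> nlinarith
  rw [h2]
  nlinarith

lemma sq_increment_le_mul_of_eq_start {τ r θ : ℝ} (hτ : 1 ≤ τ) (hr : τ ≤ r) (hr2 : r ^ 2 ≤ τ ^ 2 + r)
    (hθ0 : 0 ≤ θ) (hθ : θ * (τ + 1) ≤ τ) :
    (θ * (r ^ 2 - τ ^ 2)) ^ 2 ≤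
      (r - 1) * (θ * r ^ 2 + r - θ * (r ^ 2 - τ ^ 2)) := by
  set d := r ^ 2 - τ ^ 2 with hd
  have hd0 : 0 ≤ d := by nlinarith
  have hdr : d ≤ r := by linarith
  have hd1 : d ≤ (r - 1) * (r + 1) := by nlinarith
  have hθr : θ * (r + 1) ≤ r := by nlinarith
  have e1 : d ^ 2 ≤ r * ((r - 1) * (r + 1)) := by nlinarith
  have e2 : θ ^ 2 * d ^ 2 ≤ θ ^ 2 * (r * ((r - 1) * (r + 1))) := by gcongr
  have e3 : θ * (θ * (r + 1)) * (r * (r - 1)) ≤ θ * r * (r * (r - 1)) := by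
    have : 0 ≤ r * (r - 1) := by nlinarith
    gcongr
  have e4 : θ * d ≤ θ * r := by gcongr
  have e5 : (r - 1) * (θ * d) ≤ (r - 1) * (θ * r) := by
    apply mul_le_mul_of_nonneg_left e4; linarith
  have hθ1 : θ ≤ 1 := by nlinarith
  have e6 : 0 ≤ (r * (r - 1)) * (1 - θ) := by
    have : 0 ≤ r * (r - 1) := by nlinarith
    nlinarith
  nlinarith

lemma sq_increment_div_le_slack_mul_of_eq_start {τ r θ : ℝ} (hτ : 1 ≤ τ) (hr : τ ≤ r) (hr2 : r ^ 2 ≤ τ ^ 2 + r)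
    (hθ0 : 0 ≤ θ) (hθ : θ * (τ + 1) ≤ τ) :
    (θ * (r ^ 2 - τ ^ 2) / r) ^ 2 ≤
      (r - τ / 2 - τ / (8 * r)) / (τ + 1) * (r - 1) := by
  have h := growth_le hτ hr2
  have h8 : 1 / (8 * τ) ≤ 1 / 8 := by
    apply one_div_le_one_div_of_le <;> linarith
  obtain ⟨s, rfl⟩ : ∃ s, τ = 1 + s := ⟨τ - 1, by ring⟩
  obtain ⟨δ, rfl⟩ : ∃ δ, r = 1 + s + δ := ⟨r - (1 + s), by ring⟩
  have hs : 0 ≤ s := by linarith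
  have hδ : 0 ≤ δ := by linarith
  have hδ1 : δ ≤ 5 / 8 := by linarith
  set r := 1 + s + δ with hrd
  set d := r ^ 2 - (1 + s) ^ 2 with hd
  have hd0 : 0 ≤ d := by nlinarith
  have e1 : (θ * d) * (2 + s) ≤ (1 + s) * d := by nlinarith
  have e2 : ((θ * d) * (2 + s)) ^ 2 ≤ ((1 + s) * d) ^ 2 := by gcongr
  have key : ((1 + s) * d) ^ 2 ≤
      (r ^ 2 - (1 + s) * r / 2 - (1 + s) / 8) * (r - 1) * r * (2 + s) := by
    have p0 : 0 ≤ δ * (3 / 4 - δ / 4) := mul_nonneg hδ (by linarith)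
    have p1 : 0 ≤ s * (3 / 4 + δ * (53 / 8 - 11 / 8 * δ - 5 / 2 * δ ^ 2 - δ ^ 3)) := by
      refine mul_nonneg hs (add_nonneg (by norm_num) (mul_nonneg hδ ?_))
      have : δ ^ 2 ≤ 1 := by nlinarith
      have : δ ^ 3 ≤ 1 := by nlinarith
      linarith
    have p2 : 0 ≤ s ^ 2 *
        (23 / 8 + δ * (109 / 8 - 69 / 8 * δ - 17 / 2 * δ ^ 2 - δ ^ 3)) := by
      refine mul_nonneg (by positivity) (add_nonneg (by norm_num) (mul_nonneg hδ ?_))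
      have : δ ^ 2 ≤ 25 / 64 := by nlinarith
      have : δ ^ 3 ≤ 1 := by nlinarith
      linarith
    have p3 : 0 ≤ s ^ 3 * (4 + δ * (41 / 4 - 23 / 2 * δ - 4 * δ ^ 2)) := by
      refine mul_nonneg (by positivity) (add_nonneg (by norm_num) (mul_nonneg hδ ?_))
      have : δ ^ 2 ≤ 25 / 64 := by nlinarith
      linarith
    have p4 : 0 ≤ s ^ 4 * (19 / 8 + δ * (5 / 2 - 4 * δ)) :=
      mul_nonneg (by positivity) (add_nonneg (by norm_num) (mul_nonneg hδ (by linarith)))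
    have p5 : 0 ≤ δ ^ 3 + δ ^ 4 + s ^ 5 / 2 := by positivity
    rw [hd, hrd]
    linarith
  have : (r - (1 + s) / 2 - (1 + s) / (8 * r)) / (1 + s + 1) * (r - 1) =
    ((r ^ 2 - (1 + s) * r / 2 - (1 + s) / 8) * (r - 1) * r * (2 + s)) / (r * (2 + s)) ^ 2 := by
    have : r ≠ 0 := by positivity
    have : 2 + s ≠ 0 := by positivity
    have : 1 + s + 1 ≠ 0 := by positivity
    field_simp
    ring
  rw [this, le_div_iff₀ (by positivity)]
  refine le_trans (le_of_eq ?_) (e2.trans key)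
  have : r ≠ 0 := by positivity
  field_simp

lemma increment_le_sub_one {τ r θ T : ℝ} (hτ : 1 ≤ τ) (hr : τ ≤ r) (hr2 : r ^ 2 ≤ τ ^ 2 + r)
    (hθ0 : 0 ≤ θ) (hθ : θ * (τ + 1) ≤ τ) (hT : r ≤ T)
    (hA : r ^ 2 - T ^ 2 + T ≤ θ * (r ^ 2 - τ ^ 2)) :
    θ * (r ^ 2 - τ ^ 2) ≤ T - 1 := by
  set d := r ^ 2 - τ ^ 2 with hd
  have hd0 : 0 ≤ d := by nlinarith
  have hc0 : 0 ≤ θ * d := mul_nonneg hθ0 hd0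
  set c := θ * d with hcd
  have hcτ : c * (τ + 1) ≤ τ * d := by nlinarith
  have hdr : d ≤ r := by linarith
  have h8 : d * (2 * τ ^ 2 - 1) ≤ 2 * τ ^ 3 + τ ^ 2 := by
    have hg := growth_le hτ hr2
    have hx : τ * (1 / (8 * τ)) = 1 / 8 := by field_simp
    have : d * (2 * τ ^ 2 - 1) ≤ (τ + 1 / 2 + 1 / (8 * τ)) * (2 * τ ^ 2 - 1) := by
      gcongr
      · nlinarith
      · linarith
    have hx0 : 0 ≤ 1 / (8 * τ) := by positivity
    nlinarith
  have hd2 : d ^ 2 ≤ d + τ ^ 2 := by nlinarith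
  have hcc : (c ^ 2 + 2 * c) * (τ + 1) ^ 2 ≤ r ^ 2 * (τ + 1) ^ 2 := by
    have e1 : (c * (τ + 1)) ^ 2 ≤ (τ * d) ^ 2 := by gcongr
    nlinarith
  have hcc' : c ^ 2 + 2 * c ≤ r ^ 2 := le_of_mul_le_mul_right hcc (by positivity)
  by_contra! h
  nlinarith

lemma sq_increment_le_mul {τ r θ T : ℝ} (hτ : 1 ≤ τ) (hr : τ ≤ r) (hr2 : r ^ 2 ≤ τ ^ 2 + r)
    (hθ0 : 0 ≤ θ) (hθ : θ * (τ + 1) ≤ τ) (hT : r ≤ T)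
    (hA : r ^ 2 - T ^ 2 + T ≤ θ * (r ^ 2 - τ ^ 2)) :
    (θ * (r ^ 2 - τ ^ 2)) ^ 2 ≤
      (T - 1 - θ * (r ^ 2 - τ ^ 2) / 2) * (θ * T ^ 2 + T - θ * (r ^ 2 - τ ^ 2)) := by
  have hc := increment_le_sub_one hτ hr hr2 hθ0 hθ hT hA
  have hcT : θ * (r ^ 2 - τ ^ 2) ≤ θ * T := by gcongr; linarith
  have hc0 : 0 ≤ θ * (r ^ 2 - τ ^ 2) := mul_nonneg hθ0 (by nlinarith)
  set c := θ * (r ^ 2 - τ ^ 2) with hcd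
  have hm : 3 * c ≤ θ * T ^ 2 + T := by
    have h1 : θ * (T + 1) ≤ T := by nlinarith
    have h2 : θ * (3 - T) ≤ 1 := by
      rcases le_total 3 T with h | h
      · nlinarith
      · nlinarith [mul_le_mul_of_nonneg_right h1 (sub_nonneg.2 h), sq_nonneg (T - 1)]
    nlinarith
  nlinarith

lemma sq_increment_div_le_slack_mul {τ r θ T : ℝ} (hτ : 1 ≤ τ) (hr : τ ≤ r) (hr2 : r ^ 2 ≤ τ ^ 2 + r)
    (hθ0 : 0 ≤ θ) (hθ : θ * (τ + 1) ≤ τ) (hT : r ≤ T)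
    (hA : r ^ 2 - T ^ 2 + T ≤ θ * (r ^ 2 - τ ^ 2)) :
    (θ * (r ^ 2 - τ ^ 2) / T) ^ 2 ≤
      (T - τ / 2 - τ / (8 * T)) / (τ + 1) * (T - 1 - θ * (r ^ 2 - τ ^ 2) / 2) := by
  have hc := increment_le_sub_one hτ hr hr2 hθ0 hθ hT hA
  have hd0 : 0 ≤ r ^ 2 - τ ^ 2 := by nlinarith
  have hc0 : 0 ≤ θ * (r ^ 2 - τ ^ 2) := mul_nonneg hθ0 hd0
  have hcτ : θ * (r ^ 2 - τ ^ 2) * (τ + 1) ≤ τ * (r ^ 2 - τ ^ 2) := by nlinarith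
  set c := θ * (r ^ 2 - τ ^ 2) with hcd
  have hT0 : 0 < T := by linarith
  have hcτ2 : c ≤ τ * (T ^ 2 - T - τ ^ 2) := by nlinarith
  have hpoly : 0 ≤ T ^ 3 - 3 / 2 * τ * T ^ 2 + τ ^ 3 - 9 / 8 * τ * T - T + 2 * τ + 1 := by
    obtain ⟨x, rfl⟩ : ∃ x, T = τ + x := ⟨T - τ, by ring⟩
    have hx : 0 ≤ x := by linarith
    have a1 : 0 ≤ τ * (x - 3 / 8) ^ 2 := by positivity
    have a2 : 0 ≤ τ * (τ - 9 / 8) ^ 2 := by positivity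
    have a3 : 0 ≤ (x + 1) * (x - 1 / 2) ^ 2 := by positivity
    nlinarith
  have hG : 2 * c * (τ + 1) ≤ T ^ 2 * (T - τ / 2) - τ * T / 8 := by nlinarith
  have hσ : 2 * c / T ^ 2 ≤ (T - τ / 2 - τ / (8 * T)) / (τ + 1) := by
    rw [div_le_div_iff₀ (by positivity) (by positivity)]
    have : τ / (8 * T) * T ^ 2 = τ * T / 8 := by field_simp
    nlinarith
  calc (c / T) ^ 2 = 2 * c / T ^ 2 * (c / 2) := by field_simp
    _ ≤ _ := by
      apply mul_le_mul hσ (by linarith) (by positivity)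
      exact le_trans (by positivity) hσ

lemma quadratic_form_nonneg {E : Type*} [NormedAddCommGroup E] [InnerProductSpace ℝ E]
    {a b d : ℝ} (ha : 0 < a) (h : b ^ 2 ≤ d * a) (p f : E) :
    0 ≤ a * ‖p‖ ^ 2 + 2 * b * ⟪p, f⟫ + d * ‖f‖ ^ 2 := by
  have h1 : ‖a • p + b • f‖ ^ 2 = a ^ 2 * ‖p‖ ^ 2 + 2 * a * b * ⟪p, f⟫ + b ^ 2 * ‖f‖ ^ 2 := by
    rw [norm_add_sq_real, norm_smul, norm_smul, real_inner_smul_left, real_inner_smul_right,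
      mul_pow, mul_pow, Real.norm_eq_abs, Real.norm_eq_abs, sq_abs, sq_abs]
    ring
  have h2 : 0 ≤ ‖a • p + b • f‖ ^ 2 := by positivity
  have h3 : 0 ≤ (d * a - b ^ 2) * ‖f‖ ^ 2 := mul_nonneg (by linarith) (by positivity)
  have h4 : 0 ≤ a * (a * ‖p‖ ^ 2 + 2 * b * ⟪p, f⟫ + d * ‖f‖ ^ 2) := by nlinarith
  exact nonneg_of_mul_nonneg_right h4 ha

lemma half_mul_norm_sq_le {E : Type*} [NormedAddCommGroup E] [InnerProductSpace ℝ E]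
    {c D : ℝ} (hc : 0 ≤ c) (hD : c ≤ D) (p w z : E) :
    c / 2 * ‖p - z‖ ^ 2 ≤ D * ‖p - w‖ ^ 2 + c * ‖w - z‖ ^ 2 := by
  have h1 : ‖p - z‖ ≤ ‖p - w‖ + ‖w - z‖ := norm_sub_le_norm_sub_add_norm_sub p w z
  have h2 : ‖p - z‖ ^ 2 ≤ 2 * (‖p - w‖ ^ 2 + ‖w - z‖ ^ 2) := by
    nlinarith [norm_nonneg (p - z), sq_nonneg (‖p - w‖ - ‖w - z‖)]
  have h3 : c * ‖p - w‖ ^ 2 ≤ D * ‖p - w‖ ^ 2 := by gcongr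
  nlinarith

lemma mul_sub_norm_sq_le {E : Type*} [NormedAddCommGroup E] [InnerProductSpace ℝ E]
    {c m q h D : ℝ} {p w z : E} (hm : 0 < m - c)
    (hdet : c ^ 2 ≤ (q + h - c) * (m - c))
    (hh : h * ‖p - z‖ ^ 2 ≤ D * ‖p - w‖ ^ 2 + c * ‖w - z‖ ^ 2) :
    c * (‖z‖ ^ 2 - ‖w - z‖ ^ 2) ≤ m * ‖p‖ ^ 2 + q * ‖p - z‖ ^ 2 + D * ‖p - w‖ ^ 2 := by
  have h1 := quadratic_form_nonneg hm hdet p (p - z)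
  have h2 : ‖z‖ ^ 2 = ‖p‖ ^ 2 - 2 * ⟪p, p - z⟫ + ‖p - z‖ ^ 2 := by
    rw [← norm_sub_sq_real, sub_sub_cancel]
  rw [h2]
  linarith

lemma mul_sub_norm_sq_le_add_averaged {E : Type*} [NormedAddCommGroup E] [InnerProductSpace ℝ E]
    {c σ q h D T : ℝ} {p w z z' : E} (hT : 0 < T) (hσ : 0 < σ)
    (hdet : (c / T) ^ 2 ≤ (q + h - c) * σ)
    (hz' : z' = (1 / T) • p + ((T - 1) / T) • z)
    (hh : h * ‖p - z‖ ^ 2 ≤ D * ‖p - w‖ ^ 2 + c * ‖w - z‖ ^ 2) :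
    c * (‖z‖ ^ 2 - ‖w - z‖ ^ 2) ≤ σ * ‖p‖ ^ 2 + q * ‖p - z‖ ^ 2 + D * ‖p - w‖ ^ 2 +
      c * (‖z'‖ ^ 2 - ‖p - z'‖ ^ 2) := by
  have h1 := quadratic_form_nonneg hσ hdet p (p - z)
  have h2 : ‖z‖ ^ 2 = ‖p‖ ^ 2 - 2 * ⟪p, p - z⟫ + ‖p - z‖ ^ 2 := by
    rw [← norm_sub_sq_real, sub_sub_cancel]
  have h3 : ‖z'‖ ^ 2 - ‖p - z'‖ ^ 2 = 2 * ⟪p, z'⟫ - ‖p‖ ^ 2 := by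
    rw [norm_sub_sq_real]; ring
  have h4 : z' = p - ((T - 1) / T) • (p - z) := by
    have : (1 / T : ℝ) = 1 - (T - 1) / T := by field_simp; ring
    rw [hz', this]; module
  have h5 : ⟪p, z'⟫ = ‖p‖ ^ 2 - (T - 1) / T * ⟪p, p - z⟫ := by
    rw [h4, inner_sub_right, real_inner_smul_right, real_inner_self_eq_norm_sq]
  have h6 : (T - 1) / T = 1 - 1 / T := by field_simp
  rw [h3, h5, h2, h6]
  have h7 : c / T = c * (1 / T) := by ring
  rw [h7] at h1
  linarith

lemma le_of_forall_one_sub_mul_le {a b : ℝ}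
    (h : ∀ s : ℝ, 0 < s → s < 1 → (1 - s) * a ≤ b) : a ≤ b := by
  have h1 : Filter.Tendsto (fun s : ℝ => (1 - s) * a) (nhdsWithin 0 (Set.Ioi 0))
      (nhds ((1 - 0) * a)) := by
    apply Filter.Tendsto.mono_left _ nhdsWithin_le_nhds
    exact Continuous.tendsto (by fun_prop) 0
  have h2 := le_of_tendsto h1 (b := b) (by
    filter_upwards [Ioo_mem_nhdsGT (zero_lt_one' ℝ)] with s hs using h s hs.1 hs.2)
  simpa using h2

/-- The subgradient inequality improved by strong convexity. -/
lemma StrongConvexOn.subgradient_add_sq_le {E : Type*} [NormedAddCommGroup E]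
    [InnerProductSpace ℝ E] {g : E → ℝ} {μ : ℝ} (hg : StrongConvexOn Set.univ μ g)
    {v ζ : E} (hζ : ∀ z, g v + ⟪ζ, z - v⟫ ≤ g z) (z : E) :
    g v + ⟪ζ, z - v⟫ + μ / 2 * ‖z - v‖ ^ 2 ≤ g z := by
  suffices μ / 2 * ‖z - v‖ ^ 2 ≤ g z - g v - ⟪ζ, z - v⟫ by linarith
  refine le_of_forall_one_sub_mul_le fun s hs0 hs1 => ?_
  have h1 := hg.2 (Set.mem_univ v) (Set.mem_univ z) (sub_nonneg.2 hs1.le) hs0.le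
    (sub_add_cancel 1 s)
  have h2 := hζ ((1 - s) • v + s • z)
  have h3 : (1 - s) • v + s • z - v = s • (z - v) := by module
  rw [h3, real_inner_smul_right] at h2
  rw [norm_sub_rev v z] at h1
  simp only [smul_eq_mul] at h1
  have h4 : s * ((1 - s) * (μ / 2 * ‖z - v‖ ^ 2)) ≤ s * (g z - g v - ⟪ζ, z - v⟫) := by
    linarith
  exact le_of_mul_le_mul_left h4 hs0

lemma ConvexOn.gradient_inner_le {E : Type*} [NormedAddCommGroup E] [InnerProductSpace ℝ E]
    [CompleteSpace E] {f : E → ℝ} (hf : ConvexOn ℝ Set.univ f) {x f' : E}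
    (hf' : HasGradientAt f f' x) (z : E) : f x + ⟪f', z - x⟫ ≤ f z := by
  have h1 : ConvexOn ℝ Set.univ (f ∘ (AffineMap.lineMap x z : ℝ →ᵃ[ℝ] E)) := by
    simpa using hf.comp_affineMap (AffineMap.lineMap x z : ℝ →ᵃ[ℝ] E)
  have h2 : HasDerivAt (f ∘ (AffineMap.lineMap x z : ℝ →ᵃ[ℝ] E)) ⟪f', z - x⟫ 0 := by
    have h3 : HasFDerivAt f (InnerProductSpace.toDual ℝ E f')
        ((AffineMap.lineMap x z : ℝ →ᵃ[ℝ] E) 0) := by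
      simpa using hf'.hasFDerivAt
    have h4 := h3.comp_hasDerivAt 0 (AffineMap.hasDerivAt_lineMap (a := x) (b := z) (x := (0:ℝ)))
    simpa using h4
  have h5 := h1.le_slope_of_hasDerivAt (Set.mem_univ 0) (Set.mem_univ 1) zero_lt_one h2
  simp [slope_def_field] at h5
  linarith

/-- The descent lemma for a function with Lipschitz gradient. -/
lemma le_add_inner_add_sq_of_lipschitz_gradient {E : Type*} [NormedAddCommGroup E]
    [InnerProductSpace ℝ E] [CompleteSpace E] {f : E → ℝ} {f' : E → E} {L : ℝ}
    (hf' : ∀ x, HasGradientAt f (f' x) x) (hL : ∀ x y, ‖f' x - f' y‖ ≤ L * ‖x - y‖) (x z : E) :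
    f z ≤ f x + ⟪f' x, z - x⟫ + L / 2 * ‖z - x‖ ^ 2 := by
  set φ : ℝ → ℝ := fun s => f (AffineMap.lineMap x z s) -
    (s * ⟪f' x, z - x⟫ + L / 2 * s ^ 2 * ‖z - x‖ ^ 2) with hφ
  have hd : ∀ s, HasDerivAt φ (⟪f' (AffineMap.lineMap x z s), z - x⟫ -
      (⟪f' x, z - x⟫ + L * s * ‖z - x‖ ^ 2)) s := by
    intro s
    have h4 := (hf' (AffineMap.lineMap x z s)).hasFDerivAt.comp_hasDerivAt s
      (AffineMap.hasDerivAt_lineMap (a := x) (b := z) (x := s))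
    have h5 : HasDerivAt (fun s : ℝ => s * ⟪f' x, z - x⟫ + L / 2 * s ^ 2 * ‖z - x‖ ^ 2)
        (⟪f' x, z - x⟫ + L * s * ‖z - x‖ ^ 2) s := by
      have h6 := ((hasDerivAt_id s).mul_const ⟪f' x, z - x⟫).add
        ((((hasDerivAt_id s).pow 2).const_mul (L / 2)).mul_const (‖z - x‖ ^ 2))
      refine h6.congr_deriv ?_
      simp only [id_eq, Nat.add_one_sub_one, pow_one, Nat.cast_ofNat]
      ring
    refine (h4.sub h5).congr_deriv ?_
    simp
  have hanti : AntitoneOn φ (Set.Icc 0 1) := by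
    apply antitoneOn_of_deriv_nonpos (convex_Icc 0 1)
    · exact fun s _ => (hd s).continuousAt.continuousWithinAt
    · exact fun s _ => (hd s).differentiableAt.differentiableWithinAt
    · intro s hs
      rw [interior_Icc] at hs
      rw [(hd s).deriv]
      have h1 : ⟪f' (AffineMap.lineMap x z s) - f' x, z - x⟫ ≤ L * s * ‖z - x‖ ^ 2 := by
        calc _ ≤ ‖f' (AffineMap.lineMap x z s) - f' x‖ * ‖z - x‖ := real_inner_le_norm _ _
          _ ≤ L * ‖AffineMap.lineMap x z s - x‖ * ‖z - x‖ := by gcongr; exact hL _ _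
          _ = _ := by
            rw [AffineMap.lineMap_apply_module', add_sub_cancel_right, norm_smul,
              Real.norm_eq_abs, abs_of_pos hs.1]
            ring
      rw [inner_sub_left] at h1
      linarith
  have h := hanti (Set.left_mem_Icc.2 zero_le_one) (Set.right_mem_Icc.2 zero_le_one) zero_le_one
  simp [hφ] at h
  linarith

/-- One accelerated proximal gradient step on a composite objective `h₁ + h₂`. -/
lemma composite_step_le {E : Type*} [NormedAddCommGroup E] [InnerProductSpace ℝ E]
    [CompleteSpace E] {h₁ h₂ : E → ℝ} {h₂' : E → E} {μ L T : ℝ}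
    (hh₁ : StrongConvexOn Set.univ μ h₁) (hh₂ : ConvexOn ℝ Set.univ h₂)
    (hgrad : ∀ x, HasGradientAt h₂ (h₂' x) x)
    (hlip : ∀ x y, ‖h₂' x - h₂' y‖ ≤ L * ‖x - y‖) (hT : 1 ≤ T) {u u' x x' xbar ξ : E}
    (hx' : x' = (1 / T) • u' + ((T - 1) / T) • x) (hxbar : xbar = x + (1 / T) • (u - x))
    (hξ : ∀ z, h₁ u' + ⟪ξ, z - u'⟫ ≤ h₁ z) (q : E) :
    T ^ 2 * (h₁ x' + h₂ x') + T * (μ / 2) * ‖u' - q‖ ^ 2 + (T - 1) * (μ / 2) * ‖u' - x‖ ^ 2 ≤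
      (T ^ 2 - T) * (h₁ x + h₂ x) + T * (h₁ q + h₂ q) + T * ⟪ξ + h₂' xbar, u' - q⟫ +
        L / 2 * ‖u' - u‖ ^ 2 := by
  have hT0 : 0 < T := by linarith
  have hw : 1 / T + (T - 1) / T = 1 := by field_simp; ring
  have j := hh₁.2 (Set.mem_univ u') (Set.mem_univ x) (by positivity)
    (div_nonneg (by linarith) hT0.le) hw
  rw [← hx'] at j
  simp only [smul_eq_mul] at j
  have s := hh₁.subgradient_add_sq_le hξ q
  rw [norm_sub_rev q u', ← neg_sub u' q, inner_neg_right] at s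
  have d := le_add_inner_add_sq_of_lipschitz_gradient hgrad hlip xbar x'
  have e1 : x' - xbar = (1 / T) • (u' - u) := by
    have : (T - 1) / T = 1 - 1 / T := by linarith
    rw [hx', hxbar, this]; module
  have e2 : x' - xbar = (1 / T) • (u' - q) + (1 / T) • (q - xbar) +
      ((T - 1) / T) • (x - xbar) := by
    have : (T - 1) / T = 1 - 1 / T := by linarith
    rw [hx', this]; module
  have g1 := hh₂.gradient_inner_le (hgrad xbar) q
  have g2 := hh₂.gradient_inner_le (hgrad xbar) x
  have e3 : ‖x' - xbar‖ ^ 2 = (1 / T) ^ 2 * ‖u' - u‖ ^ 2 := by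
    rw [e1, norm_smul, mul_pow, Real.norm_eq_abs, sq_abs]
  rw [e3, e2, inner_add_right, inner_add_right, real_inner_smul_right, real_inner_smul_right,
    real_inner_smul_right] at d
  rw [inner_add_left]
  have j' := mul_le_mul_of_nonneg_left j (sq_nonneg T)
  have d' := mul_le_mul_of_nonneg_left d (sq_nonneg T)
  have s' := mul_le_mul_of_nonneg_left s hT0.le
  have g1' := mul_le_mul_of_nonneg_left g1 hT0.le
  have g2' := mul_le_mul_of_nonneg_left g2 (by nlinarith : 0 ≤ T ^ 2 - T)
  field_simp at j' d'
  linarith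

lemma multiplier_step_le {E : Type*} [NormedAddCommGroup E] [InnerProductSpace ℝ E]
    {γ T : ℝ} (hγ : 0 < γ) (l P Q Q₀ : E) :
    -(T * ⟪l + (γ * T) • (P + Q₀), P⟫) - T * ⟪l + (γ * T) • (P + Q), Q⟫ ≤
      1 / (2 * γ) * (‖l‖ ^ 2 - ‖l + (γ * T) • (P + Q)‖ ^ 2) +
        γ * T ^ 2 / 2 * (‖Q₀‖ ^ 2 - ‖Q‖ ^ 2) := by
  have h : 0 ≤ γ * T ^ 2 / 2 * ‖P + Q₀‖ ^ 2 := by positivity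
  have h1 : ‖l + (γ * T) • (P + Q)‖ ^ 2 = ‖l‖ ^ 2 + 2 * (γ * T) * (⟪l, P⟫ + ⟪l, Q⟫) +
      (γ * T) ^ 2 * ‖P + Q‖ ^ 2 := by
    rw [norm_add_sq_real, norm_smul, real_inner_smul_right, mul_pow, Real.norm_eq_abs, sq_abs,
      inner_add_right]
    ring
  rw [h1, norm_add_sq_real P Q]
  rw [norm_add_sq_real P Q₀] at h
  simp only [inner_add_left, real_inner_smul_left, real_inner_self_eq_norm_sq]
  rw [real_inner_comm P Q₀] at *
  have h2 : 1 / (2 * γ) * (‖l‖ ^ 2 - (‖l‖ ^ 2 + 2 * (γ * T) * (⟪l, P⟫ + ⟪l, Q⟫) +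
      (γ * T) ^ 2 * (‖P‖ ^ 2 + 2 * ⟪P, Q⟫ + ‖Q‖ ^ 2))) =
      -(T * (⟪l, P⟫ + ⟪l, Q⟫)) - γ * T ^ 2 / 2 * (‖P‖ ^ 2 + 2 * ⟪P, Q⟫ + ‖Q‖ ^ 2) := by
    field_simp
    ring
  rw [h2]
  linarith

lemma norm_le_of_weighted_sum {E : Type*} [SeminormedAddCommGroup E] [NormedSpace ℝ E]
    {h : ℕ → E} {a : ℕ → ℝ} {C : ℝ} (ha0 : ∀ k, 0 ≤ a k) (ha1 : ∀ k, a k ≤ 1)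
    (hC : ∀ n, ‖h n + ∑ k ∈ Finset.range n, a k • h k‖ ≤ C) (n : ℕ) : ‖h n‖ ≤ 2 * C := by
  have hC0 : 0 ≤ C := (norm_nonneg _).trans (hC 0)
  have hS : ∀ n, ‖∑ k ∈ Finset.range n, a k • h k‖ ≤ C := by
    intro n
    induction n with
    | zero => simpa using hC0
    | succ n ih =>
      have e : ∑ k ∈ Finset.range (n + 1), a k • h k =
          (1 - a n) • ∑ k ∈ Finset.range n, a k • h k +
            a n • (h n + ∑ k ∈ Finset.range n, a k • h k) := by
        rw [Finset.sum_range_succ]; module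
      rw [e]
      refine (norm_add_le _ _).trans ?_
      rw [norm_smul, norm_smul, Real.norm_of_nonneg (ha0 n),
        Real.norm_of_nonneg (sub_nonneg.2 (ha1 n))]
      nlinarith [hC n, ha0 n, ha1 n,
        mul_le_mul_of_nonneg_left ih (sub_nonneg.2 (ha1 n)),
        mul_le_mul_of_nonneg_left (hC n) (ha0 n)]
  have e : h n = (h n + ∑ k ∈ Finset.range n, a k • h k) - ∑ k ∈ Finset.range n, a k • h k := by
    abel
  rw [e]
  refine (norm_sub_le _ _).trans ?_
  linarith [hC n, hS n]

/-- The bound on the energy `t k ^ 2 * D k + R k` obtained by telescoping the one-step estimate.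
The potential itself may exceed `M` at the first index; the excess is carried along as a multiple of
`‖z k‖ ^ 2 - ‖w k - z k‖ ^ 2`, which the averaging step absorbs. -/
lemma potential_le {E : Type*} [NormedAddCommGroup E] [InnerProductSpace ℝ E]
    {t D R b : ℕ → ℝ} {w z : ℕ → E} {ν θ η : ℝ} (ht1 : 1 < t 1)
    (htmono : ∀ k ≥ 1, t k ≤ t (k + 1)) (htrec : ∀ k ≥ 1, t (k + 1) ^ 2 ≤ t k ^ 2 + t (k + 1))
    (hν : 0 < ν) (hθ : 0 ≤ θ) (hη : 0 ≤ η) (hθη : (θ + η) * (t 1 + 1) ≤ t 1)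
    (hb0 : ∀ k, 0 ≤ b k) (hb : ∀ k, b k ≤ ν * η * ‖w k‖ ^ 2)
    (hD : ∀ k, ν * ‖z k‖ ^ 2 ≤ D k) (hwz : w 1 = z 1)
    (hz : ∀ k ≥ 1, z (k + 1) =
      (1 / t (k + 1)) • w (k + 1) + ((t (k + 1) - 1) / t (k + 1)) • z k)
    (hstep : ∀ k ≥ 1, t (k + 1) ^ 2 * D (k + 1) + R (k + 1) +
        ν * (θ * t (k + 1) ^ 2 + t (k + 1)) * ‖w (k + 1)‖ ^ 2 + t (k + 1) ^ 2 * b (k + 1) +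
        ν * (t (k + 1) - 1) * ‖w (k + 1) - z k‖ ^ 2 +
        ν * θ * (t (k + 1) ^ 2 - t 1 ^ 2) * ‖w (k + 1) - w k‖ ^ 2 ≤
      (t (k + 1) ^ 2 - t (k + 1)) * D k + R k + ν * θ * t (k + 1) ^ 2 * ‖w k‖ ^ 2 +
        t (k + 1) ^ 2 * b k) {k : ℕ} (hk : 1 ≤ k) :
    t k ^ 2 * D k + R k ≤
      t 1 ^ 2 * D 1 + R 1 + ν * θ * t 1 ^ 2 * ‖w 1‖ ^ 2 + t 2 ^ 2 * b 1 := by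
  set M := t 1 ^ 2 * D 1 + R 1 + ν * θ * t 1 ^ 2 * ‖w 1‖ ^ 2 + t 2 ^ 2 * b 1 with hM
  set c := θ * (t 2 ^ 2 - t 1 ^ 2) with hc
  set Φ : ℕ → ℝ := fun k => t k ^ 2 * D k + R k + ν * θ * t (k + 1) ^ 2 * ‖w k‖ ^ 2 +
    t (k + 1) ^ 2 * b k with hΦ
  have h12 : t 1 ≤ t 2 := htmono 1 le_rfl
  have hr2 : t 2 ^ 2 ≤ t 1 ^ 2 + t 2 := htrec 1 le_rfl
  have hτ : ∀ k ≥ 1, t 1 ≤ t k := fun k hk =>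
    Nat.le_induction le_rfl (fun j hj ih => ih.trans (htmono j hj)) k hk
  have hr : ∀ k ≥ 1, t 2 ≤ t (k + 1) := fun k hk =>
    Nat.le_induction le_rfl (fun j hj ih => ih.trans (htmono (j + 1) (by omega))) k hk
  have hc0 : 0 ≤ c :=
    mul_nonneg hθ (sub_nonneg.2 (pow_le_pow_left₀ (by linarith) h12 2))
  have hθτ : θ * (t 1 + 1) ≤ t 1 := by nlinarith
  suffices H : ∀ k ≥ 1, (Φ k ≤ M ∨ Φ k ≤ M + ν * (c * (‖z k‖ ^ 2 - ‖w k - z k‖ ^ 2))) ∧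
      t k ^ 2 * D k + R k ≤ M from (H k hk).2
  intro k hk
  induction k, hk using Nat.le_induction with
  | base =>
    refine ⟨Or.inr (le_of_eq ?_), ?_⟩
    · rw [hwz, sub_self, norm_zero]
      simp only [hΦ, hM, hc, hwz]
      ring
    · have : 0 ≤ ν * θ * t 1 ^ 2 * ‖w 1‖ ^ 2 := by positivity
      have : 0 ≤ t 2 ^ 2 * b 1 := mul_nonneg (by positivity) (hb0 1)
      linarith
  | succ k hk ih =>
    have hs := hstep k hk
    have hz' := hz k hk
    have hTr := hr k hk
    have hTk := htmono k hk
    have hτk := hτ k hk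
    have hA0 : 0 ≤ t k ^ 2 - t (k + 1) ^ 2 + t (k + 1) := by linarith [htrec k hk]
    have hAD := mul_le_mul_of_nonneg_left (hD k) hA0
    have hσ := slack_le_sub_increment ht1.le (by linarith) (htmono (k + 1) (by omega))
      (htrec (k + 1) (by omega)) hθη (by positivity) (T := t (k + 1))
    have hbw := mul_le_mul_of_nonneg_left (hb (k + 1))
      (sub_nonneg.2 (pow_le_pow_left₀ (by linarith) (htmono (k + 1) (by omega)) 2))
    have hbp := mul_nonneg (sq_nonneg (t (k + 1))) (hb0 (k + 1))
    generalize hTe : t (k + 1) = T at *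
    generalize hTe' : t (k + 1 + 1) = T' at *
    have hT0 : 1 < T := by linarith
    set σ := (T - t 1 / 2 - t 1 / (8 * T)) / (t 1 + 1) with hσd
    have hσ0 : 0 < σ := by
      have : t 1 / (8 * T) < 1 / 2 * T := by
        rw [div_lt_iff₀ (by positivity)]
        have := mul_lt_mul_of_pos_right hT0 (zero_lt_one.trans hT0)
        linarith
      exact div_pos (by linarith) (by linarith)
    set A := t k ^ 2 - T ^ 2 + T with hA
    set p := w (k + 1) with hp
    have hσw := mul_le_mul_of_nonneg_right hσ (by positivity : 0 ≤ ν * ‖p‖ ^ 2)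
    have hfin : T ^ 2 * D (k + 1) + R (k + 1) + ν * ((θ * T ^ 2 + T) * ‖p‖ ^ 2 +
        (T - 1) * ‖p - z k‖ ^ 2 + θ * (T ^ 2 - t 1 ^ 2) * ‖p - w k‖ ^ 2 + A * ‖z k‖ ^ 2) ≤ Φ k := by
      simp only [hΦ, hTe]
      linarith
    have hdes : Φ (k + 1) + ν * (σ * ‖p‖ ^ 2 +
        (T - 1) * ‖p - z k‖ ^ 2 + θ * (T ^ 2 - t 1 ^ 2) * ‖p - w k‖ ^ 2 + A * ‖z k‖ ^ 2) ≤ Φ k := by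
      simp only [hΦ, hTe, hTe', ← hp]
      linarith
    have hq0 : 0 ≤ (T - 1) * ‖p - z k‖ ^ 2 := mul_nonneg (by linarith) (by positivity)
    have hd0 : 0 ≤ θ * (T ^ 2 - t 1 ^ 2) * ‖p - w k‖ ^ 2 :=
      mul_nonneg (mul_nonneg hθ (sub_nonneg.2
        (pow_le_pow_left₀ (by linarith) (by linarith) 2))) (by positivity)
    have hσp : 0 ≤ σ * ‖p‖ ^ 2 := by positivity
    have hmp : 0 ≤ (θ * T ^ 2 + T) * ‖p‖ ^ 2 := by positivity
    have hAz : 0 ≤ A * ‖z k‖ ^ 2 := by positivity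
    have hwz0 : 0 ≤ c * ‖w k - z k‖ ^ 2 := by positivity
    have hcm : 0 < θ * T ^ 2 + T - c := by
      have h1 := mul_nonneg hθ (sq_nonneg (t 1))
      have h2 : θ * t 2 ^ 2 ≤ θ * T ^ 2 := by gcongr; linarith
      linarith
    have hq1 := mul_nonneg hν.le hq0
    have hd1 := mul_nonneg hν.le hd0
    have hσ1 := mul_nonneg hν.le hσp
    have hm1 := mul_nonneg hν.le hmp
    have hA1 := mul_nonneg hν.le hAz
    have hwz1 := mul_nonneg hν.le hwz0
    rcases ih.1 with h | h
    · exact ⟨Or.inl (by linarith), by linarith⟩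
    rcases le_or_gt c A with hcA | hcA
    · have h1 := mul_le_mul_of_nonneg_left
        (mul_le_mul_of_nonneg_right hcA (sq_nonneg ‖z k‖)) hν.le
      exact ⟨Or.inl (by linarith), by linarith⟩
    · obtain ⟨h', hh, hdf, hds⟩ : ∃ h',
          h' * ‖p - z k‖ ^ 2 ≤ θ * (T ^ 2 - t 1 ^ 2) * ‖p - w k‖ ^ 2 + c * ‖w k - z k‖ ^ 2 ∧
          c ^ 2 ≤ (T - 1 + h' - c) * (θ * T ^ 2 + T - c) ∧
          (c / T) ^ 2 ≤ (T - 1 + h' - c) * σ := by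
        rcases hk.eq_or_lt with rfl | hk2
        · obtain rfl : t 2 = T := hTe
          refine ⟨c, by rw [hwz, sub_self, norm_zero]; simp [hc], ?_, ?_⟩
          · rw [add_sub_cancel_right]
            exact sq_increment_le_mul_of_eq_start ht1.le h12 hr2 hθ hθτ
          · rw [add_sub_cancel_right, mul_comm]
            exact sq_increment_div_le_slack_mul_of_eq_start ht1.le h12 hr2 hθ hθτ
        · have hrk : t 2 ≤ t k := by
            obtain ⟨j, rfl⟩ : ∃ j, k = j + 1 := ⟨k - 1, by omega⟩
            exact hr j (by omega)
          have hsq : t 2 ^ 2 ≤ t k ^ 2 := by gcongr; linarith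
          have hA' : t 2 ^ 2 - T ^ 2 + T ≤ θ * (t 2 ^ 2 - t 1 ^ 2) := by linarith
          refine ⟨c / 2, half_mul_norm_sq_le hc0 ?_ p (w k) (z k), ?_, ?_⟩
          · rw [hc]
            gcongr
            linarith
          · rw [show T - 1 + c / 2 - c = T - 1 - c / 2 by ring]
            exact sq_increment_le_mul ht1.le h12 hr2 hθ hθτ hTr hA'
          · rw [show T - 1 + c / 2 - c = T - 1 - c / 2 by ring, mul_comm]
            exact sq_increment_div_le_slack_mul ht1.le h12 hr2 hθ hθτ hTr hA'
      have h1 := mul_le_mul_of_nonneg_left (mul_sub_norm_sq_le hcm hdf hh) hν.le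
      have h2 := mul_le_mul_of_nonneg_left
        (mul_sub_norm_sq_le_add_averaged (by linarith) hσ0 hds hz' hh) hν.le
      exact ⟨Or.inr (by linarith), by linarith⟩

/-- The extrapolated point is an average of `x k` and `u k`. -/
lemma extrapolation_eq {E : Type*} [AddCommGroup E] [Module ℝ E] {t : ℕ → ℝ} {x u xbar : ℕ → E}
    (ht : ∀ k ≥ 1, 0 < t k) (hx0 : x 0 = x 1) (hu1 : u 1 = x 1)
    (hxbar : ∀ k ≥ 1, xbar k = x k + ((t k - 1) / t (k + 1)) • (x k - x (k - 1)))
    (hx : ∀ k ≥ 1, x (k + 1) =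
      (1 / t (k + 1)) • u (k + 1) + ((t (k + 1) - 1) / t (k + 1)) • x k) {k : ℕ} (hk : 1 ≤ k) :
    xbar k = x k + (1 / t (k + 1)) • (u k - x k) := by
  have h : u k - x k = (t k - 1) • (x k - x (k - 1)) := by
    rcases hk.eq_or_lt with rfl | hk
    · simp [hx0, hu1]
    · obtain ⟨j, rfl⟩ : ∃ j, k = j + 1 := ⟨k - 1, by omega⟩
      have hj : t (j + 1) ≠ 0 := (ht _ (by omega)).ne'
      have e : t (j + 1) • x (j + 1) = u (j + 1) + (t (j + 1) - 1) • x j := by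
        rw [hx j (by omega), smul_add, smul_smul, smul_smul, mul_one_div_cancel hj, one_smul,
          mul_div_cancel₀ _ hj]
      rw [Nat.add_sub_cancel, smul_sub, sub_smul, e]
      module
  rw [hxbar k hk, h, smul_smul]
  congr 2
  ring

lemma StrongConvexOn.add_sq_le_of_forall_le {E F : Type*} [NormedAddCommGroup E]
    [NormedSpace ℝ E] [NormedAddCommGroup F] [NormedSpace ℝ F] {f : E → ℝ} {g : F → ℝ} {μ : ℝ}
    (hg : StrongConvexOn Set.univ μ g) (hf : ConvexOn ℝ Set.univ f) {xs : E} {ys : F}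
    (hmin : ∀ x y, f xs + g ys ≤ f x + g y) (x : E) (y : F) :
    f xs + g ys + μ / 2 * ‖y - ys‖ ^ 2 ≤ f x + g y := by
  suffices μ / 2 * ‖y - ys‖ ^ 2 ≤ f x + g y - (f xs + g ys) by linarith
  refine le_of_forall_one_sub_mul_le fun s hs0 hs1 => ?_
  have h1 := hg.2 (Set.mem_univ ys) (Set.mem_univ y) (sub_nonneg.2 hs1.le) hs0.le
    (sub_add_cancel 1 s)
  have h2 := hf.2 (Set.mem_univ xs) (Set.mem_univ x) (sub_nonneg.2 hs1.le) hs0.le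
    (sub_add_cancel 1 s)
  have h3 := hmin ((1 - s) • xs + s • x) ((1 - s) • ys + s • y)
  rw [norm_sub_rev ys y] at h1
  simp only [smul_eq_mul] at h1 h2
  have h4 : s * ((1 - s) * (μ / 2 * ‖y - ys‖ ^ 2)) ≤ s * (f x + g y - (f xs + g ys)) := by
    linarith
  exact le_of_mul_le_mul_left h4 hs0

lemma mul_inner_eq_of_sub_eq {E G : Type*} [NormedAddCommGroup E] [InnerProductSpace ℝ E]
    [CompleteSpace E] [NormedAddCommGroup G] [InnerProductSpace ℝ G] [CompleteSpace G]
    {K : E →L[ℝ] G} {s T : ℝ} (hs : s ≠ 0) {u u' d : E} {l : G}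
    (hu : u' - u = -(s • (d + ContinuousLinearMap.adjoint K l))) (q : E) :
    T * ⟪d, u' - q⟫ = -(T / (2 * s)) * (‖u' - u‖ ^ 2 + ‖u' - q‖ ^ 2 - ‖u - q‖ ^ 2) -
      T * ⟪l, K (u' - q)⟫ := by
  have h1 : ‖u - q‖ ^ 2 = ‖u' - q‖ ^ 2 - 2 * ⟪u' - u, u' - q⟫ + ‖u' - u‖ ^ 2 := by
    rw [show u - q = (u' - q) - (u' - u) by abel, norm_sub_sq_real, real_inner_comm]
  have h2 : ⟪u' - u, u' - q⟫ = -(s * (⟪d, u' - q⟫ + ⟪l, K (u' - q)⟫)) := by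
    conv_lhs => rw [hu]
    rw [inner_neg_left, real_inner_smul_left, inner_add_left,
      ContinuousLinearMap.adjoint_inner_left]
  rw [h1, h2]
  field_simp
  ring

/-- The energy estimate for one iteration of the accelerated linearized ADMM. -/
lemma linearized_admm_step_le {E F G : Type*} [NormedAddCommGroup E] [InnerProductSpace ℝ E]
    [CompleteSpace E] [NormedAddCommGroup F] [InnerProductSpace ℝ F] [CompleteSpace F]
    [NormedAddCommGroup G] [InnerProductSpace ℝ G] [CompleteSpace G]
    {A : E →L[ℝ] G} {B : F →L[ℝ] G} {b : G} {f1 f2 : E → ℝ} {g1 g2 : F → ℝ}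
    {f2' : E → E} {g2' : F → F} {Lf2 Lg2 μ : ℝ}
    (hf1 : ConvexOn ℝ Set.univ f1) (hf2 : ConvexOn ℝ Set.univ f2)
    (hf2grad : ∀ x, HasGradientAt f2 (f2' x) x)
    (hf2lip : ∀ x y, ‖f2' x - f2' y‖ ≤ Lf2 * ‖x - y‖)
    (hg1 : StrongConvexOn Set.univ μ g1) (hg2 : ConvexOn ℝ Set.univ g2)
    (hg2grad : ∀ y, HasGradientAt g2 (g2' y) y)
    (hg2lip : ∀ x y, ‖g2' x - g2' y‖ ≤ Lg2 * ‖x - y‖)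
    {α β γ τ T : ℝ} (hα : 0 < α) (hβ : 0 < β) (hγ : 0 < γ) (hT : 1 ≤ T)
    (hαL : Lf2 ≤ 1 / α) (hβL : Lg2 ≤ τ ^ 2 / β)
    {x x' xbar u u' ξ : E} {y y' ybar v v' ζ : F} {l l' lbar : G}
    (hxbar : xbar = x + (1 / T) • (u - x)) (hybar : ybar = y + (1 / T) • (v - y))
    (hξ : ∀ z, f1 u' + ⟪ξ, z - u'⟫ ≤ f1 z) (hζ : ∀ z, g1 v' + ⟪ζ, z - v'⟫ ≤ g1 z)
    (hu : u' - u = -((α * T) • (ξ + f2' xbar + ContinuousLinearMap.adjoint A lbar)))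
    (hv : v' - v = -((β / T) • (ζ + g2' ybar + ContinuousLinearMap.adjoint B l')))
    (hx' : x' = (1 / T) • u' + ((T - 1) / T) • x) (hy' : y' = (1 / T) • v' + ((T - 1) / T) • y)
    (hl' : l' = l + (γ * T) • (A u' + B v' - b)) (hlbar : lbar = l + (γ * T) • (A u' + B v - b))
    {xs : E} {ys : F} (hb : A xs + B ys = b) (ls : G) :
    T ^ 2 * (f1 x' + f2 x' + g1 y' + g2 y' + ⟪ls, A x' + B y' - b⟫ -
          (f1 xs + f2 xs + g1 ys + g2 ys)) +
        (1 / (2 * α) * ‖u' - xs‖ ^ 2 + 1 / (2 * γ) * ‖l' - ls‖ ^ 2) +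
        (T ^ 2 / (2 * β) + T * (μ / 2)) * ‖v' - ys‖ ^ 2 + T ^ 2 * (γ / 2 * ‖B (v' - ys)‖ ^ 2) +
        (T - 1) * (μ / 2) * ‖v' - y‖ ^ 2 + (T ^ 2 - τ ^ 2) / (2 * β) * ‖v' - v‖ ^ 2 ≤
      (T ^ 2 - T) * (f1 x + f2 x + g1 y + g2 y + ⟪ls, A x + B y - b⟫ -
          (f1 xs + f2 xs + g1 ys + g2 ys)) +
        (1 / (2 * α) * ‖u - xs‖ ^ 2 + 1 / (2 * γ) * ‖l - ls‖ ^ 2) +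
        T ^ 2 / (2 * β) * ‖v - ys‖ ^ 2 + T ^ 2 * (γ / 2 * ‖B (v - ys)‖ ^ 2) := by
  have hT0 : 0 < T := by linarith
  have hf := composite_step_le (strongConvexOn_zero.2 hf1) hf2 hf2grad hf2lip hT hx' hxbar hξ xs
  have hg := composite_step_le hg1 hg2 hg2grad hg2lip hT hy' hybar hζ ys
  rw [mul_inner_eq_of_sub_eq (by positivity) hu xs,
    show T / (2 * (α * T)) = 1 / (2 * α) by field_simp] at hf
  rw [mul_inner_eq_of_sub_eq (by positivity) hv ys,
    show T / (2 * (β / T)) = T ^ 2 / (2 * β) by field_simp] at hg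
  have hm := multiplier_step_le (T := T) hγ (l - ls) (A (u' - xs)) (B (v' - ys)) (B (v - ys))
  have e1 : l - ls + (γ * T) • (A (u' - xs) + B (v' - ys)) = l' - ls := by
    rw [hl', ← hb, map_sub, map_sub]; module
  have e2 : l - ls + (γ * T) • (A (u' - xs) + B (v - ys)) = lbar - ls := by
    rw [hlbar, ← hb, map_sub, map_sub]; module
  rw [e1, e2, inner_sub_left, inner_sub_left] at hm
  have e3 : T * (⟪ls, A (u' - xs)⟫ + ⟪ls, B (v' - ys)⟫) =
      T ^ 2 * ⟪ls, A x' + B y' - b⟫ - (T ^ 2 - T) * ⟪ls, A x + B y - b⟫ := by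
    rw [← inner_add_right, ← real_inner_smul_right, ← real_inner_smul_right,
      ← real_inner_smul_right, ← inner_sub_right]
    congr 1
    rw [hx', hy', ← hb]
    simp only [map_add, map_smul, map_sub]
    match_scalars <;> field_simp <;> ring
  have h1 : Lf2 / 2 * ‖u' - u‖ ^ 2 ≤ 1 / (2 * α) * ‖u' - u‖ ^ 2 := by
    rw [show 1 / (2 * α) = 1 / α / 2 by ring]
    gcongr
  have h2 : Lg2 / 2 * ‖v' - v‖ ^ 2 ≤ τ ^ 2 / (2 * β) * ‖v' - v‖ ^ 2 := by
    rw [show τ ^ 2 / (2 * β) = τ ^ 2 / β / 2 by ring]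
    gcongr
  rw [sub_div]
  linarith

/-- A bound on the multipliers gives an `O(1 / t k ^ 2)` bound on the feasibility residuals. -/
lemma sq_mul_norm_le_of_multiplier_bound {G : Type*} [NormedAddCommGroup G] [NormedSpace ℝ G]
    {t : ℕ → ℝ} {r l : ℕ → G} {γ K : ℝ} (hγ : 0 < γ) (ht : ∀ k ≥ 1, 1 ≤ t k)
    (htrec : ∀ k ≥ 1, t (k + 1) ^ 2 ≤ t k ^ 2 + t (k + 1))
    (hl : ∀ k ≥ 1, l (k + 1) =
      l k + γ • (t (k + 1) ^ 2 • r (k + 1) - (t (k + 1) ^ 2 - t (k + 1)) • r k))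
    (hK : ∀ k ≥ 1, ‖l k - l 1‖ ≤ K) {k : ℕ} (hk : 1 ≤ k) :
    t k ^ 2 * ‖r k‖ ≤ 2 * (t 1 ^ 2 * ‖r 1‖ + K / γ) := by
  set h : ℕ → G := fun n => t (n + 1) ^ 2 • r (n + 1) with hh
  set a : ℕ → ℝ := fun n => (t (n + 1) ^ 2 - t (n + 2) ^ 2 + t (n + 2)) / t (n + 1) ^ 2 with ha
  have hsum : ∀ n, h n + ∑ k ∈ Finset.range n, a k • h k = h 0 + γ⁻¹ • (l (n + 1) - l 1) := by
    intro n
    induction n with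
    | zero => simp
    | succ n ih =>
      have h1 : a n • h n = (t (n + 1) ^ 2 - t (n + 2) ^ 2 + t (n + 2)) • r (n + 1) := by
        have : t (n + 1) ≠ 0 := by linarith [ht (n + 1) (by omega)]
        rw [ha, hh, smul_smul, div_mul_cancel₀ _ (pow_ne_zero 2 this)]
      have h2 : h n + a n • h n + (h (n + 1) - h n) = h (n + 1) + a n • h n := by abel
      have h3 : γ⁻¹ • (l (n + 1 + 1) - l 1) = γ⁻¹ • (l (n + 1) - l 1) +
          (t (n + 2) ^ 2 • r (n + 2) - (t (n + 2) ^ 2 - t (n + 2)) • r (n + 1)) := by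
        rw [hl (n + 1) (by omega), add_sub_right_comm, smul_add, smul_smul,
          inv_mul_cancel₀ hγ.ne', one_smul]
      rw [Finset.sum_range_succ, h3, ← add_assoc (h 0), ← ih, h1, hh]
      module
  have hnorm : ∀ n, ‖h n‖ = t (n + 1) ^ 2 * ‖r (n + 1)‖ := fun n => by
    rw [hh, norm_smul, Real.norm_of_nonneg (sq_nonneg _)]
  obtain ⟨n, rfl⟩ : ∃ n, k = n + 1 := ⟨k - 1, by omega⟩
  rw [← hnorm n]
  refine norm_le_of_weighted_sum (a := a) (fun n => ?_) (fun n => ?_) (fun n => ?_) n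
  · exact div_nonneg (by linarith [htrec (n + 1) (by omega)]) (sq_nonneg _)
  · refine div_le_one_of_le₀ ?_ (sq_nonneg _)
    nlinarith [ht (n + 2) (by omega)]
  · rw [hsum, ← hnorm 0]
    refine (norm_add_le _ _).trans ?_
    rw [norm_smul γ⁻¹, Real.norm_of_nonneg (inv_nonneg.2 hγ.le), div_eq_inv_mul]
    gcongr
    exact hK _ (by omega)

lemma half_le_of_sqrt_recurrence {t : ℕ → ℝ} (ht1 : 1 ≤ t 1)
    (ht : ∀ k ≥ 1, t (k + 1) = (1 + Real.sqrt (1 + 4 * t k ^ 2)) / 2) {k : ℕ} (hk : 1 ≤ k) :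
    ((k : ℝ) + 1) / 2 ≤ t k := by
  induction k, hk using Nat.le_induction with
  | base => norm_num; exact ht1
  | succ k hk ih =>
    have h : 2 * t k ≤ Real.sqrt (1 + 4 * t k ^ 2) := Real.le_sqrt_of_sq_le (by linarith)
    rw [ht k hk]
    push_cast
    linarith

lemma div_sq_le_four_mul_div_sq {X s t : ℝ} (hX : 0 ≤ X) (hs : 0 < s) (hst : s / 2 ≤ t) :
    X / t ^ 2 ≤ 4 * X / s ^ 2 := by
  calc X / t ^ 2 ≤ X / (s / 2) ^ 2 := by gcongr
    _ = 4 * X / s ^ 2 := by field_simp; norm_num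

/-- Corollary 2.1: optimal parameter choice for Algorithm 1 (accelerated linearized
ADMM based on Nesterov's first scheme with `λ̂_{k+1} = λ_{k+1}`), with the additional
`O(1/k²)` rates under the classical update rule for `t_k`. -/
theorem stmt11 {m n p : ℕ}
    (A : EuclideanSpace ℝ (Fin m) →L[ℝ] EuclideanSpace ℝ (Fin p))
    (B : EuclideanSpace ℝ (Fin n) →L[ℝ] EuclideanSpace ℝ (Fin p))
    (b : EuclideanSpace ℝ (Fin p))
    (f1 f2 : EuclideanSpace ℝ (Fin m) → ℝ)
    (g1 g2 : EuclideanSpace ℝ (Fin n) → ℝ)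
    (f2' : EuclideanSpace ℝ (Fin m) → EuclideanSpace ℝ (Fin m))
    (g2' : EuclideanSpace ℝ (Fin n) → EuclideanSpace ℝ (Fin n))
    (Lf2 Lg2 μ : ℝ) (hLf2 : 0 ≤ Lf2) (hLg2 : 0 ≤ Lg2) (hμ : 0 < μ)
    -- Assumption 1.1
    (hf1lsc : LowerSemicontinuous f1) (hf1conv : ConvexOn ℝ Set.univ f1)
    (hf2conv : ConvexOn ℝ Set.univ f2)
    (hf2grad : ∀ x, HasGradientAt f2 (f2' x) x)
    (hf2lip : ∀ x y, ‖f2' x - f2' y‖ ≤ Lf2 * ‖x - y‖)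
    (hg1lsc : LowerSemicontinuous g1) (hg1sc : StrongConvexOn Set.univ μ g1)
    (hg2conv : ConvexOn ℝ Set.univ g2)
    (hg2grad : ∀ y, HasGradientAt g2 (g2' y) y)
    (hg2lip : ∀ x y, ‖g2' x - g2' y‖ ≤ Lg2 * ‖x - y‖)
    -- parameters
    (α β γ : ℝ) (hα : 0 < α) (hβ : 0 < β) (hγ : 0 < γ)
    (t : ℕ → ℝ) (htmono : ∀ k ≥ 1, t k ≤ t (k + 1))
    (ht1gt : t 1 > max 1 (Real.sqrt (2 * Lg2 / μ)))
    (hαle : α ≤ 1 / Lf2)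
    (hβmem : β ∈ Set.Ioc (1 / μ * (1 + 1 / t 1)) (t 1 ^ 2 / Lg2))
    (hγlt : γ < (t 1 * (β * μ - 1) - 1) / ((t 1 + 1) * β * ‖B‖ ^ 2))
    (htrec : ∀ k ≥ 1, t (k + 1) ^ 2 ≤ t k ^ 2 + t (k + 1))
    -- iterates of Scheme A with λ̂ = λ
    (x u xbar : ℕ → EuclideanSpace ℝ (Fin m))
    (y v ybar : ℕ → EuclideanSpace ℝ (Fin n))
    (lam lambar : ℕ → EuclideanSpace ℝ (Fin p))
    (ξ : ℕ → EuclideanSpace ℝ (Fin m)) (ζ : ℕ → EuclideanSpace ℝ (Fin n))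
    (hx0 : x 0 = x 1) (hy0 : y 0 = y 1) (hu1 : u 1 = x 1) (hv1 : v 1 = y 1)
    (hxbar : ∀ k ≥ 1, xbar k = x k + ((t k - 1) / t (k + 1)) • (x k - x (k - 1)))
    (hybar : ∀ k ≥ 1, ybar k = y k + ((t k - 1) / t (k + 1)) • (y k - y (k - 1)))
    (hξ : ∀ k ≥ 1, ∀ z, f1 (u (k + 1)) + ⟪ξ (k + 1), z - u (k + 1)⟫ ≤ f1 z)
    (hu : ∀ k ≥ 1, u (k + 1) - u k =
      -((α * t (k + 1)) • (ξ (k + 1) + f2' (xbar k) +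
        ContinuousLinearMap.adjoint A (lambar (k + 1)))))
    (hζ : ∀ k ≥ 1, ∀ z, g1 (v (k + 1)) + ⟪ζ (k + 1), z - v (k + 1)⟫ ≤ g1 z)
    (hv : ∀ k ≥ 1, v (k + 1) - v k =
      -((β / t (k + 1)) • (ζ (k + 1) + g2' (ybar k) +
        ContinuousLinearMap.adjoint B (lam (k + 1)))))
    (hxupd : ∀ k ≥ 1, x (k + 1) =
      (1 / t (k + 1)) • u (k + 1) + ((t (k + 1) - 1) / t (k + 1)) • x k)
    (hyupd : ∀ k ≥ 1, y (k + 1) =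
      (1 / t (k + 1)) • v (k + 1) + ((t (k + 1) - 1) / t (k + 1)) • y k)
    (hlam : ∀ k ≥ 1, lam (k + 1) =
      lam k + (γ * t (k + 1)) • (A (u (k + 1)) + B (v (k + 1)) - b))
    (hlambar : ∀ k ≥ 1, lambar (k + 1) =
      lam k + (γ * t (k + 1)) • (A (u (k + 1)) + B (v k) - b))
    -- saddle point
    (xs : EuclideanSpace ℝ (Fin m)) (ys : EuclideanSpace ℝ (Fin n))
    (lams : EuclideanSpace ℝ (Fin p))
    (hsaddle : ∀ xx yy ll,
      Lagr f1 f2 g1 g2 A B b xs ys ll ≤ Lagr f1 f2 g1 g2 A B b xs ys lams ∧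
      Lagr f1 f2 g1 g2 A B b xs ys lams ≤ Lagr f1 f2 g1 g2 A B b xx yy lams) :
    -- conclusion
    let E1 : ℝ :=
      t 1 ^ 2 * (Lagr f1 f2 g1 g2 A B b (x 1) (y 1) lams -
        Lagr f1 f2 g1 g2 A B b xs ys lams) +
      1 / (2 * α) * ‖x 1 - xs‖ ^ 2 + t 1 ^ 2 / (2 * β) * ‖y 1 - ys‖ ^ 2 +
      1 / (2 * γ) * ‖lam 1 - lams‖ ^ 2
    let C1 : ℝ :=
      3 * t 1 ^ 2 * ‖A (x 1) + B (y 1) - b‖ +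
        (2 * ‖lam 1 - lams‖ +
          2 * Real.sqrt (2 * γ * E1 + γ ^ 2 * t 2 ^ 2 * ‖B (y 1 - ys)‖ ^ 2)) / γ
    (∀ k ≥ 1,
      Lagr f1 f2 g1 g2 A B b (x k) (y k) lams - Lagr f1 f2 g1 g2 A B b xs ys lams ≤
        (E1 + γ * t 2 ^ 2 / 2 * ‖B (y 1 - ys)‖ ^ 2) / t k ^ 2 ∧
      ‖A (x k) + B (y k) - b‖ ≤ C1 / t k ^ 2 ∧
      |f1 (x k) + f2 (x k) + g1 (y k) + g2 (y k) -
          (f1 xs + f2 xs + g1 ys + g2 ys)| ≤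
        (E1 + γ * t 2 ^ 2 / 2 * ‖B (y 1 - ys)‖ ^ 2 + C1 * ‖lams‖) / t k ^ 2) ∧
    ((∀ k ≥ 1, t (k + 1) = (1 + Real.sqrt (1 + 4 * t k ^ 2)) / 2) →
      ∀ k ≥ 1,
        Lagr f1 f2 g1 g2 A B b (x k) (y k) lams -
            Lagr f1 f2 g1 g2 A B b xs ys lams ≤
          4 * (E1 + γ * t 2 ^ 2 / 2 * ‖B (y 1 - ys)‖ ^ 2) / ((k : ℝ) + 1) ^ 2 ∧
        ‖A (x k) + B (y k) - b‖ ≤ 4 * C1 / ((k : ℝ) + 1) ^ 2 ∧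
        |f1 (x k) + f2 (x k) + g1 (y k) + g2 (y k) -
            (f1 xs + f2 xs + g1 ys + g2 ys)| ≤
          4 * (E1 + γ * t 2 ^ 2 / 2 * ‖B (y 1 - ys)‖ ^ 2 + C1 * ‖lams‖) /
            ((k : ℝ) + 1) ^ 2) := by
  intro E1 C1
  have hτ1 : 1 < t 1 := (le_max_left _ _).trans_lt ht1gt
  have ht : ∀ k ≥ 1, 1 ≤ t k := fun k hk =>
    Nat.le_induction hτ1.le (fun j hj ih => ih.trans (htmono j hj)) k hk
  have hαL : Lf2 ≤ 1 / α := by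
    rcases hLf2.eq_or_lt with h | h
    · rw [← h]; positivity
    · rwa [le_one_div h hα]
  have hβL : Lg2 ≤ t 1 ^ 2 / β := by
    rcases hLg2.eq_or_lt with h | h
    · rw [← h]; positivity
    · rw [le_div_iff₀ hβ]
      have := (le_div_iff₀ h).1 hβmem.2
      linarith
  have hB : 0 < ‖B‖ := by
    refine (norm_nonneg B).lt_of_ne fun h => ?_
    rw [← h] at hγlt
    simp at hγlt
    linarith
  have hθη : (1 / (β * μ) + γ * ‖B‖ ^ 2 / μ) * (t 1 + 1) ≤ t 1 := by
    rw [lt_div_iff₀ (by positivity)] at hγlt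
    have : (1 / (β * μ) + γ * ‖B‖ ^ 2 / μ) * (t 1 + 1) =
        (t 1 + 1 + γ * ((t 1 + 1) * β * ‖B‖ ^ 2)) / (β * μ) := by
      field_simp
    rw [this, div_le_iff₀ (by positivity)]
    linarith
  have hb : A xs + B ys = b := by
    have h := (hsaddle xs ys (lams + (A xs + B ys - b))).1
    simp only [Lagr, inner_add_left, real_inner_self_eq_norm_sq] at h
    have h0 : ‖A xs + B ys - b‖ ^ 2 ≤ 0 := by linarith
    exact sub_eq_zero.1 (norm_eq_zero.1 (pow_eq_zero_iff two_ne_zero |>.1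
      (le_antisymm h0 (sq_nonneg _))))
  have hLs : Lagr f1 f2 g1 g2 A B b xs ys lams = f1 xs + f2 xs + (g1 ys + g2 ys) := by
    simp only [Lagr, hb, sub_self, inner_zero_right]
    ring
  set D : ℕ → ℝ := fun k => Lagr f1 f2 g1 g2 A B b (x k) (y k) lams -
    Lagr f1 f2 g1 g2 A B b xs ys lams with hDdef
  have hD : ∀ k, μ / 2 * ‖y k - ys‖ ^ 2 ≤ D k := by
    intro k
    have hf : ConvexOn ℝ Set.univ (fun x => f1 x + f2 x + ⟪lams, A x⟫) :=
      (hf1conv.add hf2conv).add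
        ((innerSL ℝ lams).toLinearMap.comp A.toLinearMap |>.convexOn convex_univ)
    have hg : StrongConvexOn Set.univ μ (fun y => g1 y + (g2 y + ⟪lams, B y⟫)) := by
      have h := hg1sc.add (strongConvexOn_zero.2 (hg2conv.add
        ((innerSL ℝ lams).toLinearMap.comp B.toLinearMap |>.convexOn convex_univ)))
      simp only [Pi.add_def, zero_div, zero_mul, add_zero] at h
      exact h
    have h := hg.add_sq_le_of_forall_le hf (xs := xs) (ys := ys) (fun x y => by
      have := (hsaddle x y lams).2
      simp only [Lagr, inner_sub_right, inner_add_right] at this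
      linarith) (x k) (y k)
    simp only [hDdef, Lagr, inner_sub_right, inner_add_right]
    linarith
  have hD0 : ∀ k, 0 ≤ D k := fun k => le_trans (by positivity) (hD k)
  set R : ℕ → ℝ := fun k => 1 / (2 * α) * ‖u k - xs‖ ^ 2 + 1 / (2 * γ) * ‖lam k - lams‖ ^ 2
    with hR
  set M := E1 + γ * t 2 ^ 2 / 2 * ‖B (y 1 - ys)‖ ^ 2 with hM
  have hpot : ∀ k ≥ 1, t k ^ 2 * D k + R k ≤ M := by
    intro k hk
    have h := potential_le (t := t) (D := D) (R := R) (w := fun k => v k - ys)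
      (z := fun k => y k - ys) (b := fun k => γ / 2 * ‖B (v k - ys)‖ ^ 2) (ν := μ / 2)
      (θ := 1 / (β * μ)) (η := γ * ‖B‖ ^ 2 / μ) hτ1 htmono htrec (by positivity)
      (by positivity) (by positivity) hθη (fun k => by positivity) (fun k => ?_) hD
      (by rw [hv1]) (fun k hk => ?_) (fun k hk => ?_) hk
    · refine h.trans (le_of_eq ?_)
      simp only [hM, E1, hR, hDdef, hu1, hv1]
      field_simp
      ring
    · have h1 := pow_le_pow_left₀ (norm_nonneg _) (B.le_opNorm (v k - ys)) 2
      calc γ / 2 * ‖B (v k - ys)‖ ^ 2 ≤ γ / 2 * (‖B‖ * ‖v k - ys‖) ^ 2 := by gcongr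
        _ = _ := by field_simp
    · have : t (k + 1) ≠ 0 := by linarith [ht (k + 1) (by omega)]
      rw [hyupd k hk]
      match_scalars <;> field_simp
      ring
    · have h1 := linearized_admm_step_le hf1conv hf2conv hf2grad hf2lip hg1sc hg2conv hg2grad
        hg2lip hα hβ hγ (ht (k + 1) (by omega)) hαL hβL
        (extrapolation_eq (fun k hk => by linarith [ht k hk]) hx0 hu1 hxbar hxupd hk)
        (extrapolation_eq (fun k hk => by linarith [ht k hk]) hy0 hv1 hybar hyupd hk)
        (hξ k hk) (hζ k hk) (hu k hk) (hv k hk) (hxupd k hk) (hyupd k hk) (hlam k hk)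
        (hlambar k hk) hb lams
      have e1 : ∀ s : ℝ, μ / 2 * (1 / (β * μ)) * s = s / (2 * β) := fun s => by field_simp
      have e2 : ∀ s : ℝ, μ / 2 * (1 / (β * μ) * s ^ 2 + s) = s ^ 2 / (2 * β) + s * (μ / 2) :=
        fun s => by field_simp
      have e3 : ∀ a c : EuclideanSpace ℝ (Fin n), a - ys - (c - ys) = a - c := fun a c => by abel
      simp only [e1, e2, e3, hDdef, hLs, hR]
      simp only [Lagr]
      linarith
  have hMR : ∀ k ≥ 1, R k ≤ M := fun k hk => by
    linarith [hpot k hk, mul_nonneg (sq_nonneg (t k)) (hD0 k)]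
  have hM0 : 0 ≤ M := le_trans (by positivity) (hMR 1 le_rfl)
  set S := Real.sqrt (2 * γ * E1 + γ ^ 2 * t 2 ^ 2 * ‖B (y 1 - ys)‖ ^ 2) with hS
  have hlamS : ∀ k ≥ 1, ‖lam k - lams‖ ≤ S := by
    intro k hk
    refine Real.le_sqrt_of_sq_le ?_
    have h1 : 1 / (2 * γ) * ‖lam k - lams‖ ^ 2 ≤ M :=
      le_trans (le_add_of_nonneg_left (by positivity)) (hMR k hk)
    rw [one_div, inv_mul_le_iff₀ (by positivity), hM] at h1
    linarith
  have hC0 : 0 ≤ C1 := by positivity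
  have hres : ∀ k ≥ 1, t k ^ 2 * ‖A (x k) + B (y k) - b‖ ≤ C1 := by
    intro k hk
    have h := sq_mul_norm_le_of_multiplier_bound (r := fun k => A (x k) + B (y k) - b)
      (l := lam) (K := ‖lam 1 - lams‖ + S) hγ ht htrec (fun k hk => ?_) (fun k hk => ?_) hk
    · refine h.trans ?_
      have h1 : 0 ≤ t 1 ^ 2 * ‖A (x 1) + B (y 1) - b‖ := by positivity
      have h2 : C1 = 3 * t 1 ^ 2 * ‖A (x 1) + B (y 1) - b‖ +
        2 * ((‖lam 1 - lams‖ + S) / γ) := by simp only [C1]; ring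
      linarith
    · have : t (k + 1) ≠ 0 := by linarith [ht (k + 1) (by omega)]
      rw [hlam k hk, hxupd k hk, hyupd k hk]
      simp only [map_add, map_smul]
      match_scalars <;> field_simp <;> ring
    · have := norm_sub_le_norm_sub_add_norm_sub (lam k) lams (lam 1)
      rw [norm_sub_rev lams] at this
      linarith [hlamS k hk]
  have hmain : ∀ k ≥ 1, D k ≤ M / t k ^ 2 ∧ ‖A (x k) + B (y k) - b‖ ≤ C1 / t k ^ 2 ∧
      |f1 (x k) + f2 (x k) + g1 (y k) + g2 (y k) - (f1 xs + f2 xs + g1 ys + g2 ys)| ≤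
        (M + C1 * ‖lams‖) / t k ^ 2 := by
    intro k hk
    have htk : 0 < t k ^ 2 := by have := ht k hk; positivity
    have hDk : D k ≤ M / t k ^ 2 := by
      rw [le_div_iff₀ htk]
      have : 0 ≤ R k := by positivity
      linarith [hpot k hk]
    have hrk : ‖A (x k) + B (y k) - b‖ ≤ C1 / t k ^ 2 := by
      rw [le_div_iff₀ htk]
      linarith [hres k hk]
    refine ⟨hDk, hrk, ?_⟩
    have h1 : f1 (x k) + f2 (x k) + g1 (y k) + g2 (y k) - (f1 xs + f2 xs + g1 ys + g2 ys) =
        D k - ⟪lams, A (x k) + B (y k) - b⟫ := by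
      simp only [hDdef, hLs]
      simp only [Lagr]
      ring
    calc _ ≤ |D k| + |⟪lams, A (x k) + B (y k) - b⟫| := by rw [h1]; exact abs_sub _ _
      _ ≤ M / t k ^ 2 + ‖lams‖ * (C1 / t k ^ 2) := by
        rw [abs_of_nonneg (hD0 k)]
        have := abs_real_inner_le_norm lams (A (x k) + B (y k) - b)
        gcongr
        exact this.trans (by gcongr)
      _ = _ := by ring
  refine ⟨hmain, fun hrec k hk => ?_⟩
  have hk2 := half_le_of_sqrt_recurrence hτ1.le hrec hk
  have hk0 : (0 : ℝ) < k + 1 := by positivity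
  obtain ⟨h1, h2, h3⟩ := hmain k hk
  exact ⟨h1.trans (div_sq_le_four_mul_div_sq hM0 hk0 hk2),
    h2.trans (div_sq_le_four_mul_div_sq hC0 hk0 hk2),
    h3.trans (div_sq_le_four_mul_div_sq (by positivity) hk0 hk2)⟩
end

section
/- (Convergence of Algorithm 5.) Under the Problem setup, let {(x_k, y_k, λ_k, u_k, v_k)}_{k≥1} satisfy Scheme B with λ̂_{k+1} = λ_{k+1}, and let (x*, y*, λ*) ∈ Ω. Assume α ≤ 1/L_{f2}, β ≤ t_1²/L_{g2}, and {t_k}_{k≥1} ⊆ [1, +∞) is nondecreasing with t_{k+1}² ≤ t_k² + t_{k+1} and t_{k+1}² ≤ t_k² + (β·μ_g/(1 + β·γ·‖B‖²))·t_k for all k ≥ 1. Then for all k ≥ 1: 𝓛(x_k, y_k, λ*) − 𝓛(x*, y*, λ*) ≤ (E_1 + (γ·t_2²/2)·‖B(y_1 − y*)‖²)/t_k²; ‖A x_k + B y_k − b‖ ≤ C_1/t_k²; and |f(x_k) + g(y_k) − f(x*) − g(y*)| ≤ (E_1 + (γ·t_2²/2)·‖B(y_1 − y*)‖² + C_1·‖λ*‖)/t_k²,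 where E_1 = t_1²·(𝓛(x_1, y_1, λ*) − 𝓛(x*, y*, λ*)) + (1/(2α))·‖x_1 − x*‖² + (t_1²/(2β))·‖y_1 − y*‖² + (1/(2γ))·‖λ_1 − λ*‖² and C_1 = 3·t_1²·‖A x_1 + B y_1 − b‖ + (2‖λ_1 − λ*‖ + 2√(2γ·E_1 + γ²·t_2²·‖B(y_1 − y*)‖²))/γ. -/
set_option autoImplicit false

open RealInnerProductSpace

theorem harmonic_growth_bound {t T : ℝ} (ht : 1 ≤ t) (htT : t ≤ T) (hT : T ^ 2 ≤ t ^ 2 + T) :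
    (8 / 5 * t + 3 / 5 * (T ^ 2 - t ^ 2) + 5 / 3) *
        ((T ^ 2 - t ^ 2) * (T + t - 1) - (T - 1) * (T - 5 / 3 * (T - 1))) ≤
      T ^ 2 * (3 / 5 * (t + (T ^ 2 - t ^ 2)) * (t + 5 / 3)) := by
  obtain ⟨D, rfl⟩ : ∃ D, T = t + D := ⟨T - t, by ring⟩
  obtain ⟨z, rfl⟩ : ∃ z, t = 1 + z := ⟨t - 1, by ring⟩
  have hz : 0 ≤ z := by linarith
  have hD : 0 ≤ D := by linarith
  have hg : D * (2 * z + 1) + D ^ 2 ≤ 1 + z := by nlinarith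
  have hs : 0 ≤ 1 + z - (D * (2 * z + 1) + D ^ 2) := by linarith
  nlinarith [mul_nonneg hz hD, mul_nonneg hz hs, mul_nonneg hD hs,
    mul_nonneg (mul_nonneg hz hD) hs, mul_nonneg (mul_nonneg hz hz) hs,
    mul_nonneg (mul_nonneg hD hD) hs, pow_nonneg hz 2, pow_nonneg hz 3, pow_nonneg hz 4,
    pow_nonneg hD 2, pow_nonneg hD 3, mul_nonneg hz (pow_nonneg hD 2),
    mul_nonneg (pow_nonneg hz 2) hD, mul_nonneg (pow_nonneg hz 3) hD]

theorem potential_step {E : Type*} [NormedAddCommGroup E] [InnerProductSpace ℝ E]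
    {t T H : ℝ} {V' Y Y' : E} (ht : 1 ≤ t) (htT : t ≤ T) (hT : T ^ 2 ≤ t ^ 2 + T)
    (hH : (T ^ 2 - t ^ 2) * (T + t - 1) ≤ T ^ 2 * H + (T - 1) * (T - 5 / 3 * (T - 1)))
    (hY : T • Y' = V' + (T - 1) • Y) :
    t * ‖Y‖ ^ 2 ≤ H * ‖V' - Y‖ ^ 2 + (T - 1) * ‖V' - Y‖ ^ 2
      + (t ^ 2 - T ^ 2 + T) * ‖Y‖ ^ 2 + T * ‖Y'‖ ^ 2 - (T + 5 / 3) * ‖V' - Y'‖ ^ 2 := by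
  have hT0 : 0 < T := by linarith
  obtain ⟨e, rfl⟩ : ∃ e, V' = Y + T • e := ⟨T⁻¹ • (V' - Y), by rw [smul_inv_smul₀ hT0.ne']; abel⟩
  have hY' : Y' = Y + e := by
    apply smul_right_injective E hT0.ne'
    simp only [hY]; module
  subst hY'
  have e1 : Y + T • e - Y = T • e := by abel
  have e2 : Y + T • e - (Y + e) = (T - 1) • e := by module
  have e3 : ‖Y + e‖ ^ 2 = ‖Y‖ ^ 2 + 2 * ⟪Y, e⟫ + ‖e‖ ^ 2 := norm_add_sq_real Y e
  rw [e1, e2, e3, norm_smul, norm_smul, mul_pow, mul_pow, Real.norm_eq_abs, Real.norm_eq_abs,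
    sq_abs, sq_abs]
  set a := ‖Y‖
  set b := ‖e‖
  have hin : -(a * b) ≤ ⟪Y, e⟫ := by
    have := abs_real_inner_le_norm Y e
    exact (abs_le.mp this).1
  -- quadratic form in `a`, `b`
  set g := T ^ 2 - t ^ 2 with hg
  have hg0 : 0 ≤ g := by nlinarith
  have hgT : g ≤ T := by linarith
  set P := T ^ 2 * H + (T - 1) * (T - 5 / 3 * (T - 1)) with hP
  have key : T ^ 2 ≤ (P + T) * (2 * T - t - g) := by
    have h1 : 0 ≤ 2 * T - t - g := by
      nlinarith
    have h2 : (g * (T + t - 1) + T) * (2 * T - t - g) ≤ (P + T) * (2 * T - t - g) :=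
      mul_le_mul_of_nonneg_right (by linarith) h1
    refine le_trans ?_ h2
    have h3 : T ^ 2 ≤ (g * (T + t - 1) + T) * (2 * T - t - g) := by
      have hs : 0 < T + t := by linarith
      have h4 : (T + t) * (2 * T - t - g) = T * (T + t) - g * (T + t - 1) := by rw [hg]; ring
      have h5 : (T + t) * T ^ 2 ≤ (T + t) * ((g * (T + t - 1) + T) * (2 * T - t - g)) := by
        have : (T + t) * ((g * (T + t - 1) + T) * (2 * T - t - g)) =
            (g * (T + t - 1) + T) * (T * (T + t) - g * (T + t - 1)) := by rw [← h4]; ring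
        rw [this]
        have h6 : 0 ≤ g * (T + t - 1) * ((T - g) * (T + t - 1)) := by
          apply mul_nonneg (mul_nonneg hg0 (by linarith)) (mul_nonneg (by linarith) (by linarith))
        nlinarith
      exact le_of_mul_le_mul_left h5 hs
    exact h3
  have hPT : 0 < P + T := by nlinarith [mul_nonneg hg0 (by linarith : 0 ≤ T + t - 1)]
  have hquad : 0 ≤ (P + T) * b ^ 2 - 2 * T * (a * b) + (2 * T - t - g) * a ^ 2 := by
    have : 0 ≤ (P + T) * ((P + T) * b ^ 2 - 2 * T * (a * b) + (2 * T - t - g) * a ^ 2) := by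
      nlinarith [sq_nonneg ((P + T) * b - T * a), mul_nonneg (sub_nonneg.2 key) (sq_nonneg a)]
    exact nonneg_of_mul_nonneg_right this hPT
  have hpoly : H * (T ^ 2 * b ^ 2) + (T - 1) * (T ^ 2 * b ^ 2) + T * b ^ 2
      - (T + 5 / 3) * ((T - 1) ^ 2 * b ^ 2) = (P + T) * b ^ 2 := by rw [hP]; ring
  nlinarith [mul_le_mul_of_nonneg_left hin hT0.le]

section
variable {E : Type*} [NormedAddCommGroup E] [InnerProductSpace ℝ E]

theorem le_of_one_sub_mul_le {c d : ℝ} (h : ∀ s : ℝ, 0 < s → s < 1 → (1 - s) * c ≤ d) : c ≤ d := by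
  by_contra! hcd
  rcases le_or_gt c 0 with hc | hc
  · have := h (1 / 2) (by norm_num) (by norm_num)
    linarith
  · rcases lt_or_ge d 0 with hd | hd
    · have := h (1 / 2) (by norm_num) (by norm_num)
      linarith
    · have := h ((c - d) / (2 * c)) (div_pos (by linarith) (by linarith))
        (by rw [div_lt_one (by linarith)]; linarith)
      have h2 : (1 - (c - d) / (2 * c)) * c = (c + d) / 2 := by field_simp; ring
      linarith

theorem strongConvexOn_subgradient {g : E → ℝ} {μ : ℝ} (hg : StrongConvexOn Set.univ μ g)
    {y ζ : E} (hζ : ∀ z, g y + ⟪ζ, z - y⟫ ≤ g z) (z : E) :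
    g y + ⟪ζ, z - y⟫ + μ / 2 * ‖z - y‖ ^ 2 ≤ g z := by
  suffices h : μ / 2 * ‖z - y‖ ^ 2 ≤ g z - g y - ⟪ζ, z - y⟫ by linarith
  refine le_of_one_sub_mul_le fun s hs hs1 => ?_
  have h1 := hg.2 (Set.mem_univ z) (Set.mem_univ y) hs.le (sub_nonneg.2 hs1.le)
    (add_sub_cancel s 1)
  have h2 := hζ (s • z + (1 - s) • y)
  have h3 : s • z + (1 - s) • y - y = s • (z - y) := by module
  rw [h3, inner_smul_right] at h2
  simp only [smul_eq_mul] at h1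
  refine le_of_mul_le_mul_left ?_ hs
  linarith

theorem le_add_inner_of_lipschitz_gradient [CompleteSpace E] {f : E → ℝ} {f' : E → E} {L : ℝ}
    (hgrad : ∀ x, HasGradientAt f (f' x) x) (hlip : ∀ x y, ‖f' x - f' y‖ ≤ L * ‖x - y‖) (x z : E) :
    f z ≤ f x + ⟪f' x, z - x⟫ + L / 2 * ‖z - x‖ ^ 2 := by
  set d := z - x with hd
  let φ : ℝ → ℝ := fun s => f (x + s • d) - s * ⟪f' x, d⟫ - L / 2 * ‖d‖ ^ 2 * s ^ 2
  have hderiv : ∀ s, HasDerivAt φ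
      (⟪f' (x + s • d), d⟫ - ⟪f' x, d⟫ - L / 2 * ‖d‖ ^ 2 * (2 * s)) s := by
    intro s
    have h1 : HasDerivAt (fun s : ℝ => x + s • d) d s := by
      simpa using ((hasDerivAt_id s).smul_const d).const_add x
    have h2 : HasDerivAt (fun s : ℝ => f (x + s • d)) ⟪f' (x + s • d), d⟫ s := by
      have := (hgrad (x + s • d)).hasFDerivAt.comp_hasDerivAt s h1
      simpa using! this
    have h3 : HasDerivAt (fun s : ℝ => s * ⟪f' x, d⟫) ⟪f' x, d⟫ s := by
      simpa using (hasDerivAt_id s).mul_const ⟪f' x, d⟫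
    have h4 : HasDerivAt (fun s : ℝ => L / 2 * ‖d‖ ^ 2 * s ^ 2) (L / 2 * ‖d‖ ^ 2 * (2 * s)) s := by
      simpa using (hasDerivAt_pow 2 s).const_mul (L / 2 * ‖d‖ ^ 2)
    exact (h2.sub h3).sub h4
  have hanti : AntitoneOn φ (Set.Icc 0 1) := by
    refine antitoneOn_of_deriv_nonpos (convex_Icc 0 1)
      (fun s _ => (hderiv s).continuousAt.continuousWithinAt)
      (fun s _ => (hderiv s).differentiableAt.differentiableWithinAt) fun s hs => ?_
    rw [interior_Icc] at hs
    rw [(hderiv s).deriv]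
    have h1 : ⟪f' (x + s • d) - f' x, d⟫ ≤ L * (s * ‖d‖) * ‖d‖ := by
      refine (real_inner_le_norm _ _).trans (mul_le_mul_of_nonneg_right ?_ (norm_nonneg d))
      have := hlip (x + s • d) x
      rwa [add_sub_cancel_left, norm_smul, Real.norm_eq_abs, abs_of_pos hs.1] at this
    rw [inner_sub_left] at h1
    nlinarith
  have h := hanti (Set.left_mem_Icc.2 zero_le_one) (Set.right_mem_Icc.2 zero_le_one) zero_le_one
  simp only [φ, one_smul, zero_smul, add_zero, hd, add_sub_cancel] at h
  simp only [hd]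
  linarith

theorem ConvexOn.add_inner_gradient_le [CompleteSpace E] {f : E → ℝ} {x f'x : E}
    (hf : ConvexOn ℝ Set.univ f) (hgrad : HasGradientAt f f'x x) (z : E) :
    f x + ⟪f'x, z - x⟫ ≤ f z := by
  set d := z - x with hd
  have h1 : HasDerivAt (fun s : ℝ => x + s • d) d 0 := by
    simpa using ((hasDerivAt_id (0 : ℝ)).smul_const d).const_add x
  have h2 : HasDerivAt (fun s : ℝ => f (x + s • d)) ⟪f'x, d⟫ 0 := by
    have hg : HasGradientAt f f'x (x + (0 : ℝ) • d) := by simpa using hgrad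
    have := hg.hasFDerivAt.comp_hasDerivAt (0 : ℝ) h1
    simpa using! this
  have hconv : ConvexOn ℝ Set.univ (fun s : ℝ => f (x + s • d)) := by
    have := hf.comp_affineMap (AffineMap.lineMap x z : ℝ →ᵃ[ℝ] E)
    simpa [Function.comp_def, AffineMap.lineMap_apply, hd, add_comm] using! this
  have h3 := hconv.le_slope_of_hasDerivAt (Set.mem_univ 0) (Set.mem_univ 1) zero_lt_one h2
  simp [slope_def_field, hd] at h3
  linarith

theorem composite_step_bound {F₁ F₂ : E → ℝ} {x x' x₀ z u u' ξ c : E} {T L σ : ℝ} (hT : 1 ≤ T)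
    (h₁ : ∀ w, F₁ x' + ⟪ξ, w - x'⟫ + σ / 2 * ‖w - x'‖ ^ 2 ≤ F₁ w)
    (h₂ : ∀ w, F₂ x₀ + ⟪c, w - x₀⟫ ≤ F₂ w)
    (h₃ : F₂ x' ≤ F₂ x₀ + ⟪c, x' - x₀⟫ + L / 2 * ‖x' - x₀‖ ^ 2)
    (hx' : T • x' = u' + (T - 1) • x) (hx₀ : T • x₀ = u + (T - 1) • x) :
    T ^ 2 * (F₁ x' + F₂ x') - (T ^ 2 - T) * (F₁ x + F₂ x) - T * (F₁ z + F₂ z) ≤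
      T * ⟪ξ + c, u' - z⟫ + L / 2 * ‖u' - u‖ ^ 2
        - σ / 2 * ((T ^ 2 - T) * ‖x - x'‖ ^ 2 + T * ‖z - x'‖ ^ 2) := by
  have hd : ‖u' - u‖ ^ 2 = T ^ 2 * ‖x' - x₀‖ ^ 2 := by
    have : u' - u = T • (x' - x₀) := by rw [smul_sub, hx', hx₀]; abel
    rw [this, norm_smul, mul_pow, Real.norm_eq_abs, sq_abs]
  have hu : u' = T • x' - (T - 1) • x := by rw [hx']; abel
  have hin : T * ⟪ξ + c, u' - z⟫ =
      -((T ^ 2 - T) * ⟪ξ, x - x'⟫ + T * ⟪ξ, z - x'⟫)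
      - ((T ^ 2 - T) * ⟪c, x - x₀⟫ + T * ⟪c, z - x₀⟫ - T ^ 2 * ⟪c, x' - x₀⟫) := by
    simp only [hu, inner_add_left, inner_sub_right, inner_smul_right]; ring
  have hTT : 0 ≤ T ^ 2 - T := by nlinarith
  have hT0 : 0 ≤ T := by linarith
  rw [hd, hin]
  have a1 := mul_le_mul_of_nonneg_left (h₁ x) hTT
  have a2 := mul_le_mul_of_nonneg_left (h₁ z) hT0
  have b1 := mul_le_mul_of_nonneg_left (h₂ x) hTT
  have b2 := mul_le_mul_of_nonneg_left (h₂ z) hT0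
  have b3 := mul_le_mul_of_nonneg_left h₃ (sq_nonneg T)
  linarith

theorem two_mul_inner_sub_sub (a b z : E) :
    2 * ⟪b - a, b - z⟫ = ‖b - z‖ ^ 2 + ‖b - a‖ ^ 2 - ‖a - z‖ ^ 2 := by
  have : a - z = (b - z) - (b - a) := by abel
  rw [this, norm_sub_sq_real (b - z) (b - a), real_inner_comm]; ring

theorem strong_convexity_averaging {y y' v z : E} {T : ℝ} (hT : 1 ≤ T)
    (hy : T • y' = v + (T - 1) • y) :
    (T ^ 2 - T) * ‖y - y'‖ ^ 2 + T * ‖z - y'‖ ^ 2 + 2 * T * ⟪v - y', v - z⟫ =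
      T * ‖v - z‖ ^ 2 + (T - 1) * ‖v - y‖ ^ 2 := by
  have hT0 : T ≠ 0 := by linarith
  have hv : v = T • y' - (T - 1) • y := by rw [hy]; abel
  obtain ⟨p, rfl⟩ : ∃ p, y = y' + p := ⟨y - y', by abel⟩
  obtain ⟨q, rfl⟩ : ∃ q, z = y' + q := ⟨z - y', by abel⟩
  have e1 : v - y' = -((T - 1) • p) := by rw [hv]; module
  have e2 : v - (y' + q) = -((T - 1) • p + q) := by rw [hv]; module
  have e3 : v - (y' + p) = -(T • p) := by rw [hv]; module
  rw [e1, e2, e3, add_sub_cancel_left, add_sub_cancel_left, inner_neg_neg, norm_neg, norm_neg,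
    norm_add_sq_real, inner_add_right]
  simp only [inner_smul_left, inner_smul_right, norm_smul, mul_pow, Real.norm_eq_abs, sq_abs,
    real_inner_self_eq_norm_sq, conj_trivial]
  ring
end

section
variable {E : Type*} [NormedAddCommGroup E] [InnerProductSpace ℝ E]

theorem mul_div_add_mul_norm_add_sq_le {w a : ℝ} (hw : 0 < w) (ha : 0 < a) (p q : E) :
    w * a / (w + a) * ‖p + q‖ ^ 2 ≤ w * ‖p‖ ^ 2 + a * ‖q‖ ^ 2 := by
  have h := sq_nonneg ‖w • p - a • q‖
  rw [norm_sub_sq_real, norm_smul, norm_smul, mul_pow, mul_pow, Real.norm_eq_abs, Real.norm_eq_abs,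
    sq_abs, sq_abs, inner_smul_left, inner_smul_right, conj_trivial] at h
  rw [norm_add_sq_real, div_mul_eq_mul_div, div_le_iff₀ (by linarith)]
  linarith

theorem potential_descent {t T : ℝ} {V V' Y Y' : E} (ht : 1 ≤ t) (htT : t ≤ T)
    (hT : T ^ 2 ≤ t ^ 2 + T) (hY : T • Y' = V' + (T - 1) • Y) :
    t * ‖Y‖ ^ 2 - (t + 5 / 3) * ‖V - Y‖ ^ 2 ≤
      3 / 5 * (t + (T ^ 2 - t ^ 2)) * ‖V' - V‖ ^ 2 + (T - 1) * ‖V' - Y‖ ^ 2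
        + (t ^ 2 - T ^ 2 + T) * ‖Y‖ ^ 2 + (T * ‖Y'‖ ^ 2 - (T + 5 / 3) * ‖V' - Y'‖ ^ 2) := by
  have hg : 0 ≤ T ^ 2 - t ^ 2 := by nlinarith
  set w := 3 / 5 * (t + (T ^ 2 - t ^ 2)) with hw
  have hw0 : 0 < w := by rw [hw]; linarith
  have h1 := mul_div_add_mul_norm_add_sq_le hw0 (by linarith : 0 < t + 5 / 3) (V' - V) (V - Y)
  rw [sub_add_sub_cancel] at h1
  have h2 := potential_step (H := w * (t + 5 / 3) / (w + (t + 5 / 3))) ht htT hT ?_ hY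
  · linarith
  · have h3 := harmonic_growth_bound ht htT hT
    have h4 : (T ^ 2 - t ^ 2) * (T + t - 1) - (T - 1) * (T - 5 / 3 * (T - 1)) ≤
        T ^ 2 * (w * (t + 5 / 3)) / (w + (t + 5 / 3)) := by
      rw [le_div_iff₀ (by linarith)]
      have e : w + (t + 5 / 3) = 8 / 5 * t + 3 / 5 * (T ^ 2 - t ^ 2) + 5 / 3 := by rw [hw]; ring
      rw [e, mul_comm]
      exact h3
    rw [mul_div_assoc] at h4
    linarith

theorem potential_descent_of_eq {t T : ℝ} {V' Y Y' : E} (ht : 1 ≤ t) (htT : t ≤ T)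
    (hT : T ^ 2 ≤ t ^ 2 + T) (hY : T • Y' = V' + (T - 1) • Y) :
    t * ‖Y‖ ^ 2 ≤ t * ‖V' - Y‖ ^ 2 + (T - 1) * ‖V' - Y‖ ^ 2
        + (t ^ 2 - T ^ 2 + T) * ‖Y‖ ^ 2 + (T * ‖Y'‖ ^ 2 - (T + 5 / 3) * ‖V' - Y'‖ ^ 2) := by
  have h2 := potential_step (H := t) ht htT hT ?_ hY
  · linarith
  · have h1 : T ≤ t + 1 := by nlinarith
    obtain ⟨D, rfl⟩ : ∃ D, T = t + D := ⟨T - t, by ring⟩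
    obtain ⟨z, rfl⟩ : ∃ z, t = 1 + z := ⟨t - 1, by ring⟩
    have hz : 0 ≤ z := by linarith
    have hD : 0 ≤ D := by linarith
    have hD1 : D ≤ 1 := by linarith
    have h3 : 0 ≤ (z + D) * ((1 + z + D) * (1 + z) - 5 / 3 * (z + D)) := by
      apply mul_nonneg (by linarith)
      nlinarith [mul_nonneg hz hD]
    have h4 : ((1 + z + D) ^ 2 - (1 + z) ^ 2) * ((1 + z + D) + (1 + z) - 1) ≤
        (1 + z + D) * ((1 + z + D) + (1 + z) - 1) :=
      mul_le_mul_of_nonneg_right (by linarith) (by linarith)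
    nlinarith

theorem potential_le_s13 {t : ℝ} (V Y : E) :
    t * ‖Y‖ ^ 2 - (t + 5 / 3) * ‖V - Y‖ ^ 2 ≤ (t + 3 / 5 * t ^ 2) * ‖V‖ ^ 2 := by
  have h := sq_nonneg ‖(5 / 3 : ℝ) • Y - (t + 5 / 3) • V‖
  rw [norm_sub_sq_real, norm_smul, norm_smul, mul_pow, mul_pow, Real.norm_eq_abs, Real.norm_eq_abs,
    sq_abs, sq_abs, inner_smul_left, inner_smul_right, conj_trivial, real_inner_comm] at h
  rw [norm_sub_sq_real]
  linarith

theorem energy_le {t δ Q N : ℕ → ℝ} {V Y : ℕ → E} {m κ : ℝ} (hm : 0 ≤ m) (hκ : 0 ≤ κ)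
    (ht1 : ∀ k ≥ 1, 1 ≤ t k) (htmono : ∀ k ≥ 1, t k ≤ t (k + 1))
    (htrec : ∀ k ≥ 1, t (k + 1) ^ 2 ≤ t k ^ 2 + t (k + 1))
    (htrec2 : ∀ k ≥ 1, t (k + 1) ^ 2 ≤ t k ^ 2 + m / (1 + κ) * t k)
    (hVY : V 1 = Y 1) (hY : ∀ k ≥ 1, t (k + 1) • Y (k + 1) = V (k + 1) + (t (k + 1) - 1) • Y k)
    (hδ : ∀ k ≥ 1, m * ‖Y k‖ ^ 2 ≤ δ k) (hN0 : ∀ k, 0 ≤ N k) (hN : ∀ k, N k ≤ κ * ‖V k‖ ^ 2)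
    (hstep : ∀ k ≥ 1, t (k + 1) ^ 2 * δ (k + 1) + Q (k + 1)
        + (t (k + 1) ^ 2 + m * t (k + 1)) * ‖V (k + 1)‖ ^ 2 + t (k + 1) ^ 2 * N (k + 1)
        + m * (t (k + 1) - 1) * ‖V (k + 1) - Y k‖ ^ 2
        + (t (k + 1) ^ 2 - t 1 ^ 2) * ‖V (k + 1) - V k‖ ^ 2 ≤
      (t (k + 1) ^ 2 - t (k + 1)) * δ k + Q k + t (k + 1) ^ 2 * ‖V k‖ ^ 2
        + t (k + 1) ^ 2 * N k) {k : ℕ} (hk : 1 ≤ k) :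
    t k ^ 2 * δ k + Q k ≤
      t 1 ^ 2 * δ 1 + Q 1 + t 1 ^ 2 * ‖V 1‖ ^ 2 + t 2 ^ 2 * N 1 := by
  set K := t 1 ^ 2 * δ 1 + Q 1 + t 1 ^ 2 * ‖V 1‖ ^ 2 + t 2 ^ 2 * N 1 with hK
  have a1 : 1 ≤ t 1 := ht1 1 le_rfl
  have a12 : t 1 ≤ t 2 := htmono 1 le_rfl
  have arec : t 2 ^ 2 ≤ t 1 ^ 2 + t 2 := htrec 1 le_rfl
  obtain ⟨c, hc⟩ : ∃ c, c = (t 2 ^ 2 - t 1 ^ 2) / t 1 := ⟨_, rfl⟩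
  have hct : c * t 1 = t 2 ^ 2 - t 1 ^ 2 := by rw [hc]; field_simp
  have hc0 : 0 ≤ c := by rw [hc]; apply div_nonneg <;> nlinarith
  have hcm : c ≤ m := by
    have h1 : t 2 ^ 2 ≤ t 1 ^ 2 + m / (1 + κ) * t 1 := htrec2 1 le_rfl
    have h2 : m / (1 + κ) ≤ m := div_le_self hm (by linarith)
    refine le_trans ?_ h2
    refine le_of_mul_le_mul_right ?_ (by linarith : 0 < t 1)
    linarith
  have h35 : 3 / 5 * t 2 ≤ t 1 := by nlinarith
  have h35c : 3 / 5 * c ≤ 1 := by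
    refine le_of_mul_le_mul_right ?_ (by linarith : 0 < t 1)
    linarith
  have hmono : ∀ j ≥ 2, t 2 ≤ t j := by
    intro j hj
    induction j, hj using Nat.le_induction with
    | base => exact le_rfl
    | succ j hj ih => exact ih.trans (htmono j (by omega))
  -- passing from the energy before a step to the energy after it
  have hpass : ∀ j ≥ 1, t j ^ 2 * δ j + Q j + t (j + 1) ^ 2 * ‖V j‖ ^ 2 + t (j + 1) ^ 2 * N j ≤
        K + c * (t j * ‖Y j‖ ^ 2 - (t j + 5 / 3) * ‖V j - Y j‖ ^ 2) →
      t (j + 1) ^ 2 * δ (j + 1) + Q (j + 1)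
        + (t (j + 1) ^ 2 + m * t (j + 1)) * ‖V (j + 1)‖ ^ 2 + t (j + 1) ^ 2 * N (j + 1) ≤
        K + c * (t (j + 1) * ‖Y (j + 1)‖ ^ 2
          - (t (j + 1) + 5 / 3) * ‖V (j + 1) - Y (j + 1)‖ ^ 2) := by
    intro j hj hinv
    have hs := hstep j hj
    have htj := ht1 j hj
    have htm := htmono j hj
    have htr := htrec j hj
    have hYj := hY j hj
    have hρ : 0 ≤ t j ^ 2 - t (j + 1) ^ 2 + t (j + 1) := by linarith
    have e1 : c * ((t j ^ 2 - t (j + 1) ^ 2 + t (j + 1)) * ‖Y j‖ ^ 2) ≤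
        (t j ^ 2 - t (j + 1) ^ 2 + t (j + 1)) * δ j := by
      have h1 : c * ‖Y j‖ ^ 2 ≤ δ j :=
        (mul_le_mul_of_nonneg_right hcm (sq_nonneg _)).trans (hδ j hj)
      have := mul_le_mul_of_nonneg_left h1 hρ
      linarith
    have e2 : c * ((t (j + 1) - 1) * ‖V (j + 1) - Y j‖ ^ 2) ≤
        m * (t (j + 1) - 1) * ‖V (j + 1) - Y j‖ ^ 2 := by
      rw [mul_assoc]
      exact mul_le_mul_of_nonneg_right hcm (mul_nonneg (by linarith) (sq_nonneg _))
    have e3 : c * (t j * ‖Y j‖ ^ 2 - (t j + 5 / 3) * ‖V j - Y j‖ ^ 2) ≤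
        (t (j + 1) ^ 2 - t 1 ^ 2) * ‖V (j + 1) - V j‖ ^ 2
        + c * ((t (j + 1) - 1) * ‖V (j + 1) - Y j‖ ^ 2)
        + c * ((t j ^ 2 - t (j + 1) ^ 2 + t (j + 1)) * ‖Y j‖ ^ 2)
        + c * (t (j + 1) * ‖Y (j + 1)‖ ^ 2
          - (t (j + 1) + 5 / 3) * ‖V (j + 1) - Y (j + 1)‖ ^ 2) := by
      rcases hj.eq_or_lt with rfl | hj2
      · have hd := mul_le_mul_of_nonneg_left (potential_descent_of_eq htj htm htr hYj) hc0
        rw [hVY, sub_self, norm_zero]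
        have : c * (t 1 * ‖V (1 + 1) - Y 1‖ ^ 2) =
            (t (1 + 1) ^ 2 - t 1 ^ 2) * ‖V (1 + 1) - Y 1‖ ^ 2 := by
          rw [← mul_assoc, hct]
        linarith
      · have hd := mul_le_mul_of_nonneg_left
          (potential_descent (V := V j) htj htm htr hYj) hc0
        have h2j := hmono j hj2
        have hw : c * (3 / 5 * (t j + (t (j + 1) ^ 2 - t j ^ 2))) ≤ t (j + 1) ^ 2 - t 1 ^ 2 := by
          have h3 : t j - t 2 ≤ t j ^ 2 - t 2 ^ 2 := by
            linarith [mul_nonneg (sub_nonneg.2 h2j) (by linarith : 0 ≤ t j + t 2 - 1)]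
          have h4 : c * (3 / 5 * t 2) ≤ t 2 ^ 2 - t 1 ^ 2 := by
            rw [← hct]; exact mul_le_mul_of_nonneg_left h35 hc0
          have h5 : 3 / 5 * c * (t j - t 2) ≤ t j ^ 2 - t 2 ^ 2 :=
            (mul_le_of_le_one_left (sub_nonneg.2 h2j) h35c).trans h3
          have h6 : 3 / 5 * c * (t (j + 1) ^ 2 - t j ^ 2) ≤ t (j + 1) ^ 2 - t j ^ 2 :=
            mul_le_of_le_one_left (sub_nonneg.2 (pow_le_pow_left₀ (by linarith) htm 2)) h35c
          linarith
        have := mul_le_mul_of_nonneg_right hw (sq_nonneg ‖V (j + 1) - V j‖)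
        linarith
    linarith
  have hbase : t 1 ^ 2 * δ 1 + Q 1 + t 2 ^ 2 * ‖V 1‖ ^ 2 + t 2 ^ 2 * N 1 ≤
      K + c * (t 1 * ‖Y 1‖ ^ 2 - (t 1 + 5 / 3) * ‖V 1 - Y 1‖ ^ 2) := by
    have : c * (t 1 * ‖Y 1‖ ^ 2) = (t 2 ^ 2 - t 1 ^ 2) * ‖Y 1‖ ^ 2 := by rw [← mul_assoc, hct]
    rw [hK, hVY, sub_self, norm_zero]
    linarith
  have hinv : ∀ j ≥ 1,
      t j ^ 2 * δ j + Q j + t (j + 1) ^ 2 * ‖V j‖ ^ 2 + t (j + 1) ^ 2 * N j ≤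
        K + c * (t j * ‖Y j‖ ^ 2 - (t j + 5 / 3) * ‖V j - Y j‖ ^ 2) := by
    intro j hj
    induction j, hj using Nat.le_induction with
    | base => exact hbase
    | succ j hj ih =>
      have h1 := hpass j hj ih
      have h2 := htrec2 (j + 1) (by omega)
      have h3 : 0 ≤ t (j + 1 + 1) ^ 2 - t (j + 1) ^ 2 := by
        have := ht1 (j + 1) (by omega)
        exact sub_nonneg.2 (pow_le_pow_left₀ (by linarith) (htmono (j + 1) (by omega)) 2)
      have h4 := mul_le_mul_of_nonneg_left (hN (j + 1)) h3
      have h5 : (t (j + 1 + 1) ^ 2 - t (j + 1) ^ 2) * (1 + κ) ≤ m * t (j + 1) := by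
        have h6 : t (j + 1 + 1) ^ 2 - t (j + 1) ^ 2 ≤ m * t (j + 1) / (1 + κ) := by
          rw [mul_div_right_comm]; linarith
        rwa [le_div_iff₀ (by linarith)] at h6
      have h7 := mul_le_mul_of_nonneg_right h5 (sq_nonneg ‖V (j + 1)‖)
      linarith
  rcases hk.eq_or_lt with rfl | hk2
  · have h1 : 0 ≤ t 1 ^ 2 * ‖V 1‖ ^ 2 := by positivity
    have h2 : 0 ≤ t 2 ^ 2 * N 1 := mul_nonneg (sq_nonneg _) (hN0 1)
    linarith
  · obtain ⟨j, rfl⟩ : ∃ j, k = j + 1 := ⟨k - 1, by omega⟩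
    have hj : 1 ≤ j := by omega
    have h1 := hpass j hj (hinv j hj)
    have h2 := mul_le_mul_of_nonneg_left
      (potential_le_s13 (t := t (j + 1)) (V (j + 1)) (Y (j + 1))) hc0
    have h3 : 0 ≤ t (j + 1) ^ 2 * N (j + 1) := mul_nonneg (sq_nonneg _) (hN0 _)
    have h4 : c * (t (j + 1) + 3 / 5 * t (j + 1) ^ 2) ≤ t (j + 1) ^ 2 + m * t (j + 1) := by
      have h6 := mul_le_mul_of_nonneg_right hcm (zero_le_one.trans (ht1 (j + 1) hk))
      have h7 := mul_le_of_le_one_left (sq_nonneg (t (j + 1))) h35c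
      linarith
    have h5 := mul_le_mul_of_nonneg_right h4 (sq_nonneg ‖V (j + 1)‖)
    linarith

end

section
variable {E F : Type*} [NormedAddCommGroup E] [InnerProductSpace ℝ E]
  [NormedAddCommGroup F] [InnerProductSpace ℝ F]

theorem two_mul_inner_of_sub_eq {c T : ℝ} {u u' w q z : E}
    (hu : u' - u = -((c * T) • (w + q))) :
    2 * c * T * ⟪w, u' - z⟫ =
      ‖u - z‖ ^ 2 - ‖u' - z‖ ^ 2 - ‖u' - u‖ ^ 2 - 2 * c * T * ⟪q, u' - z⟫ := by
  have h := two_mul_inner_sub_sub u u' z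
  have h1 : ⟪u' - u, u' - z⟫ = -(c * T * (⟪w, u' - z⟫ + ⟪q, u' - z⟫)) := by
    rw [hu, inner_neg_left, inner_smul_left, inner_add_left, conj_trivial]
  linarith

theorem primal_block_bound {F₁ F₂ : E → ℝ} {x x' x₀ z u u' ξ c q : E} {T L α : ℝ} (hT : 1 ≤ T)
    (hα : 0 < α) (hαL : α * L ≤ 1)
    (h₁ : ∀ w, F₁ x' + ⟪ξ, w - x'⟫ ≤ F₁ w)
    (h₂ : ∀ w, F₂ x₀ + ⟪c, w - x₀⟫ ≤ F₂ w)
    (h₃ : F₂ x' ≤ F₂ x₀ + ⟪c, x' - x₀⟫ + L / 2 * ‖x' - x₀‖ ^ 2)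
    (hx' : T • x' = u' + (T - 1) • x) (hx₀ : T • x₀ = u + (T - 1) • x)
    (hu : u' - u = -((α * T) • (ξ + c + q))) :
    2 * α * (T ^ 2 * (F₁ x' + F₂ x') - (T ^ 2 - T) * (F₁ x + F₂ x) - T * (F₁ z + F₂ z)) ≤
      ‖u - z‖ ^ 2 - ‖u' - z‖ ^ 2 - 2 * α * T * ⟪q, u' - z⟫ := by
  have h := composite_step_bound (z := z) (σ := 0) hT (by simpa using h₁) h₂ h₃ hx' hx₀
  have h' := mul_le_mul_of_nonneg_left h (by linarith : 0 ≤ 2 * α)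
  have e := two_mul_inner_of_sub_eq (z := z) hu
  have e2 := mul_le_mul_of_nonneg_right hαL (sq_nonneg ‖u' - u‖)
  linarith

theorem strongly_convex_block_bound {G₁ G₂ : E → ℝ} {y y' y₀ z v v' ζ c q : E} {T L β μ : ℝ}
    (hT : 1 ≤ T) (hβ : 0 < β)
    (h₁ : ∀ w, G₁ y' + ⟪ζ, w - y'⟫ + μ / 2 * ‖w - y'‖ ^ 2 ≤ G₁ w)
    (h₂ : ∀ w, G₂ y₀ + ⟪c, w - y₀⟫ ≤ G₂ w)
    (h₃ : G₂ y' ≤ G₂ y₀ + ⟪c, y' - y₀⟫ + L / 2 * ‖y' - y₀‖ ^ 2)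
    (hy' : T • y' = v' + (T - 1) • y) (hy₀ : T • y₀ = v + (T - 1) • y)
    (hv : v' - v = -((β / T) • (ζ + c + q + μ • (v' - y')))) :
    2 * β * (T ^ 2 * (G₁ y' + G₂ y') - (T ^ 2 - T) * (G₁ y + G₂ y) - T * (G₁ z + G₂ z)) ≤
      T ^ 2 * ‖v - z‖ ^ 2 - (T ^ 2 + β * μ * T) * ‖v' - z‖ ^ 2 - (T ^ 2 - β * L) * ‖v' - v‖ ^ 2
        - β * μ * (T - 1) * ‖v' - y‖ ^ 2 - 2 * β * T * ⟪q, v' - z⟫ := by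
  have hT0 : 0 < T := by linarith
  have h := composite_step_bound (z := z) hT h₁ h₂ h₃ hy' hy₀
  have h' := mul_le_mul_of_nonneg_left h (by linarith : 0 ≤ 2 * β)
  have e := two_mul_inner_sub_sub v v' z
  have e1 : T ^ 2 * ⟪v' - v, v' - z⟫ =
      -(β * T * (⟪ζ + c, v' - z⟫ + ⟪q, v' - z⟫ + μ * ⟪v' - y', v' - z⟫)) := by
    rw [hv, inner_neg_left, inner_smul_left, inner_add_left, inner_add_left, inner_smul_left]
    simp only [conj_trivial]
    field_simp
  have e2 := congrArg (fun r => β * μ * r) (strong_convexity_averaging (z := z) hT hy')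
  have e3 := congrArg (fun r => T ^ 2 * r) e
  linarith

theorem dual_block_bound {l ls a bn bo : F} {γ T : ℝ} :
    2 * γ * T * (⟪ls, a + bn⟫ - ⟪l + (γ * T) • (a + bo), a⟫ - ⟪l + (γ * T) • (a + bn), bn⟫) ≤
      ‖l - ls‖ ^ 2 - ‖l + (γ * T) • (a + bn) - ls‖ ^ 2
        + γ ^ 2 * T ^ 2 * (‖bo‖ ^ 2 - ‖bn‖ ^ 2) := by
  obtain ⟨d, rfl⟩ : ∃ d, l = ls + d := ⟨l - ls, by abel⟩
  have e1 : ls + d + (γ * T) • (a + bn) - ls = d + (γ * T) • (a + bn) := by abel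
  rw [e1, add_sub_cancel_left]
  have h := mul_nonneg (sq_nonneg (γ * T)) (sq_nonneg ‖a + bo‖)
  simp only [norm_add_sq_real, inner_add_left, inner_add_right, inner_smul_left, inner_smul_right,
    norm_smul, mul_pow, Real.norm_eq_abs, sq_abs, conj_trivial, real_inner_self_eq_norm_sq,
    real_inner_comm a bo] at h ⊢
  linarith [real_inner_comm a bo, real_inner_comm a bn]

theorem norm_le_of_weighted_recursion {a l : ℕ → F} {θ : ℕ → ℝ} {D : ℝ}
    (hθ0 : ∀ k ≥ 1, 0 ≤ θ k) (hθ1 : ∀ k ≥ 1, θ k ≤ 1)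
    (hrec : ∀ k ≥ 1, a (k + 1) - θ k • a k = l (k + 1) - l k) (hl : ∀ k ≥ 1, ‖l k‖ ≤ D)
    {k : ℕ} (hk : 1 ≤ k) : ‖a k‖ ≤ ‖a 1‖ + ‖l 1‖ + 2 * D := by
  have hD : 0 ≤ D := (norm_nonneg _).trans (hl 1 le_rfl)
  have hc : ‖a k - l k‖ ≤ ‖a 1‖ + ‖l 1‖ + D := by
    induction k, hk using Nat.le_induction with
    | base => linarith [norm_sub_le (a 1) (l 1)]
    | succ k hk ih =>
      have h0 := hθ0 k hk
      have h1 := hθ1 k hk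
      have e : a (k + 1) - l (k + 1) = θ k • (a k - l k) - (1 - θ k) • l k := by
        have : a (k + 1) = l (k + 1) - l k + θ k • a k := by rw [← hrec k hk]; abel
        rw [this]; module
      rw [e]
      refine (norm_sub_le _ _).trans ?_
      rw [norm_smul, norm_smul, Real.norm_of_nonneg h0, Real.norm_of_nonneg (sub_nonneg.2 h1)]
      have h2 := mul_le_mul_of_nonneg_left ih h0
      have h3 := mul_le_mul_of_nonneg_left ((hl k hk).trans
        (by linarith [norm_nonneg (a 1), norm_nonneg (l 1)] : D ≤ ‖a 1‖ + ‖l 1‖ + D))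
        (sub_nonneg.2 h1)
      linarith
  have := norm_le_norm_sub_add (a k) (l k)
  linarith [hl k hk]

theorem smul_eq_of_eq_average {T : ℝ} {x x' u : E} (hT : T ≠ 0)
    (h : x' = (1 / T) • u + ((T - 1) / T) • x) : T • x' = u + (T - 1) • x := by
  rw [h, smul_add, smul_smul, smul_smul, mul_one_div_cancel hT, mul_div_cancel₀ _ hT, one_smul]

theorem smul_extrapolation_eq {t : ℕ → ℝ} {x u xbar : ℕ → E} (ht : ∀ k ≥ 1, t k ≠ 0)
    (hx0 : x 0 = x 1) (hu1 : u 1 = x 1)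
    (hbar : ∀ k ≥ 1, xbar k = x k + ((t k - 1) / t (k + 1)) • (x k - x (k - 1)))
    (hx : ∀ k ≥ 1, t (k + 1) • x (k + 1) = u (k + 1) + (t (k + 1) - 1) • x k)
    {k : ℕ} (hk : 1 ≤ k) : t (k + 1) • xbar k = u k + (t (k + 1) - 1) • x k := by
  rw [hbar k hk, smul_add, smul_smul, mul_div_cancel₀ _ (ht (k + 1) (by omega))]
  rcases hk.eq_or_lt with rfl | hk2
  · rw [hu1, Nat.sub_self, hx0]; module
  · obtain ⟨j, rfl⟩ : ∃ j, k = j + 1 := ⟨k - 1, by omega⟩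
    have h : u (j + 1) = t (j + 1) • x (j + 1) - (t (j + 1) - 1) • x j := by
      rw [hx j (by omega)]; abel
    rw [h, Nat.add_sub_cancel]; module

theorem residual_recursion {E' : Type*} [NormedAddCommGroup E'] [InnerProductSpace ℝ E']
    {A : E →L[ℝ] F} {B : E' →L[ℝ] F} {b : F} {T : ℝ} {x x' u : E} {y y' v : E'}
    (hx : T • x' = u + (T - 1) • x) (hy : T • y' = v + (T - 1) • y) :
    T • (A x' + B y' - b) = (A u + B v - b) + (T - 1) • (A x + B y - b) := by
  have h1 := congrArg A hx
  have h2 := congrArg B hy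
  rw [map_add, map_smul, map_smul] at h1 h2
  rw [smul_sub, smul_add, h1, h2]
  module

end

section
variable {m n p : ℕ}
  {f1 f2 : EuclideanSpace ℝ (Fin m) → ℝ} {g1 g2 : EuclideanSpace ℝ (Fin n) → ℝ}
  {A : EuclideanSpace ℝ (Fin m) →L[ℝ] EuclideanSpace ℝ (Fin p)}
  {B : EuclideanSpace ℝ (Fin n) →L[ℝ] EuclideanSpace ℝ (Fin p)}
  {b : EuclideanSpace ℝ (Fin p)}
  {xs : EuclideanSpace ℝ (Fin m)} {ys : EuclideanSpace ℝ (Fin n)}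
  {lams : EuclideanSpace ℝ (Fin p)}

theorem feasible_of_forall_Lagr_le
    (h : ∀ l, Lagr f1 f2 g1 g2 A B b xs ys l ≤ Lagr f1 f2 g1 g2 A B b xs ys lams) :
    A xs + B ys - b = 0 := by
  have h1 := h (lams + (A xs + B ys - b))
  simp only [Lagr, inner_add_left, real_inner_self_eq_norm_sq] at h1
  have h2 : ‖A xs + B ys - b‖ ^ 2 = 0 := le_antisymm (by linarith) (sq_nonneg _)
  exact norm_eq_zero.1 (pow_eq_zero_iff two_ne_zero |>.1 h2)

theorem Lagr_quadratic_growth {μ : ℝ} (hf1 : ConvexOn ℝ Set.univ f1)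
    (hf2 : ConvexOn ℝ Set.univ f2) (hg1 : StrongConvexOn Set.univ μ g1)
    (hg2 : ConvexOn ℝ Set.univ g2)
    (hmin : ∀ x y, Lagr f1 f2 g1 g2 A B b xs ys lams ≤ Lagr f1 f2 g1 g2 A B b x y lams)
    (x : EuclideanSpace ℝ (Fin m)) (y : EuclideanSpace ℝ (Fin n)) :
    μ / 2 * ‖y - ys‖ ^ 2 ≤
      Lagr f1 f2 g1 g2 A B b x y lams - Lagr f1 f2 g1 g2 A B b xs ys lams := by
  refine le_of_one_sub_mul_le fun s hs hs1 => ?_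
  have hs' : 0 ≤ 1 - s := by linarith
  have h := hmin (s • x + (1 - s) • xs) (s • y + (1 - s) • ys)
  have a1 := hf1.2 (Set.mem_univ x) (Set.mem_univ xs) hs.le hs' (add_sub_cancel s 1)
  have a2 := hf2.2 (Set.mem_univ x) (Set.mem_univ xs) hs.le hs' (add_sub_cancel s 1)
  have a3 := hg1.2 (Set.mem_univ y) (Set.mem_univ ys) hs.le hs' (add_sub_cancel s 1)
  have a4 := hg2.2 (Set.mem_univ y) (Set.mem_univ ys) hs.le hs' (add_sub_cancel s 1)
  have e : A (s • x + (1 - s) • xs) + B (s • y + (1 - s) • ys) - b =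
      s • (A x + B y - b) + (1 - s) • (A xs + B ys - b) := by
    simp only [map_add, map_smul]; module
  simp only [Lagr, e, inner_add_right, inner_smul_right] at h ⊢
  simp only [smul_eq_mul] at a1 a2 a3 a4
  refine le_of_mul_le_mul_left ?_ hs
  linarith

theorem Lagr_step_eq {T : ℝ} {x x' u' : EuclideanSpace ℝ (Fin m)}
    {y y' v' : EuclideanSpace ℝ (Fin n)} (hfeas : A xs + B ys - b = 0)
    (hx : T • x' = u' + (T - 1) • x) (hy : T • y' = v' + (T - 1) • y) :
    T ^ 2 * (Lagr f1 f2 g1 g2 A B b x' y' lams - Lagr f1 f2 g1 g2 A B b xs ys lams)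
      - (T ^ 2 - T) * (Lagr f1 f2 g1 g2 A B b x y lams - Lagr f1 f2 g1 g2 A B b xs ys lams) =
    (T ^ 2 * (f1 x' + f2 x') - (T ^ 2 - T) * (f1 x + f2 x) - T * (f1 xs + f2 xs))
      + (T ^ 2 * (g1 y' + g2 y') - (T ^ 2 - T) * (g1 y + g2 y) - T * (g1 ys + g2 ys))
      + T * ⟪lams, A (u' - xs) + B (v' - ys)⟫ := by
  have h := congrArg (fun r => ⟪lams, r⟫) (residual_recursion (A := A) (B := B) (b := b) hx hy)
  have e : A (u' - xs) + B (v' - ys) = A u' + B v' - b := by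
    rw [map_sub, map_sub, ← sub_zero (A u' + B v' - b), ← hfeas]; abel
  simp only [inner_smul_right, inner_add_right] at h
  have h' := congrArg (fun r => T * r) h
  simp only [Lagr, hfeas, inner_zero_right, e]
  linarith

end

/-- Convergence of Algorithm 5 (Theorem 3.2): the accelerated linearized ADMM based on
Nesterov's second scheme (Scheme B), with `λ̂_{k+1} = λ_{k+1}`. -/
theorem stmt13 {m n p : ℕ}
    (A : EuclideanSpace ℝ (Fin m) →L[ℝ] EuclideanSpace ℝ (Fin p))
    (B : EuclideanSpace ℝ (Fin n) →L[ℝ] EuclideanSpace ℝ (Fin p))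
    (b : EuclideanSpace ℝ (Fin p))
    (f1 f2 : EuclideanSpace ℝ (Fin m) → ℝ)
    (g1 g2 : EuclideanSpace ℝ (Fin n) → ℝ)
    (f2' : EuclideanSpace ℝ (Fin m) → EuclideanSpace ℝ (Fin m))
    (g2' : EuclideanSpace ℝ (Fin n) → EuclideanSpace ℝ (Fin n))
    (Lf2 Lg2 μ : ℝ) (hLf2 : 0 ≤ Lf2) (hLg2 : 0 ≤ Lg2) (hμ : 0 < μ)
    -- Assumption 1.1
    (hf1lsc : LowerSemicontinuous f1) (hf1conv : ConvexOn ℝ Set.univ f1)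
    (hf2conv : ConvexOn ℝ Set.univ f2)
    (hf2grad : ∀ x, HasGradientAt f2 (f2' x) x)
    (hf2lip : ∀ x y, ‖f2' x - f2' y‖ ≤ Lf2 * ‖x - y‖)
    (hg1lsc : LowerSemicontinuous g1) (hg1sc : StrongConvexOn Set.univ μ g1)
    (hg2conv : ConvexOn ℝ Set.univ g2)
    (hg2grad : ∀ y, HasGradientAt g2 (g2' y) y)
    (hg2lip : ∀ x y, ‖g2' x - g2' y‖ ≤ Lg2 * ‖x - y‖)
    -- parameters
    (α β γ : ℝ) (hα : 0 < α) (hβ : 0 < β) (hγ : 0 < γ)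
    (t : ℕ → ℝ) (ht1 : ∀ k ≥ 1, 1 ≤ t k) (htmono : ∀ k ≥ 1, t k ≤ t (k + 1))
    (hαle : α ≤ 1 / Lf2) (hβle : β ≤ t 1 ^ 2 / Lg2)
    (htrec : ∀ k ≥ 1, t (k + 1) ^ 2 ≤ t k ^ 2 + t (k + 1))
    (htrec2 : ∀ k ≥ 1,
      t (k + 1) ^ 2 ≤ t k ^ 2 + β * μ / (1 + β * γ * ‖B‖ ^ 2) * t k)
    -- iterates of Scheme B with λ̂ = λ
    (x u xbar : ℕ → EuclideanSpace ℝ (Fin m))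
    (y v ybar : ℕ → EuclideanSpace ℝ (Fin n))
    (lam lambar : ℕ → EuclideanSpace ℝ (Fin p))
    (ξ : ℕ → EuclideanSpace ℝ (Fin m)) (ζ : ℕ → EuclideanSpace ℝ (Fin n))
    (hx0 : x 0 = x 1) (hy0 : y 0 = y 1) (hu1 : u 1 = x 1) (hv1 : v 1 = y 1)
    (hxbar : ∀ k ≥ 1, xbar k = x k + ((t k - 1) / t (k + 1)) • (x k - x (k - 1)))
    (hybar : ∀ k ≥ 1, ybar k = y k + ((t k - 1) / t (k + 1)) • (y k - y (k - 1)))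
    (hξ : ∀ k ≥ 1, ∀ z, f1 (x (k + 1)) + ⟪ξ (k + 1), z - x (k + 1)⟫ ≤ f1 z)
    (hu : ∀ k ≥ 1, u (k + 1) - u k =
      -((α * t (k + 1)) • (ξ (k + 1) + f2' (xbar k) +
        ContinuousLinearMap.adjoint A (lambar (k + 1)))))
    (hζ : ∀ k ≥ 1, ∀ z, g1 (y (k + 1)) + ⟪ζ (k + 1), z - y (k + 1)⟫ ≤ g1 z)
    (hv : ∀ k ≥ 1, v (k + 1) - v k =
      -((β / t (k + 1)) • (ζ (k + 1) + g2' (ybar k) +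
        ContinuousLinearMap.adjoint B (lam (k + 1)) +
        μ • (v (k + 1) - y (k + 1)))))
    (hxupd : ∀ k ≥ 1, x (k + 1) =
      (1 / t (k + 1)) • u (k + 1) + ((t (k + 1) - 1) / t (k + 1)) • x k)
    (hyupd : ∀ k ≥ 1, y (k + 1) =
      (1 / t (k + 1)) • v (k + 1) + ((t (k + 1) - 1) / t (k + 1)) • y k)
    (hlam : ∀ k ≥ 1, lam (k + 1) =
      lam k + (γ * t (k + 1)) • (A (u (k + 1)) + B (v (k + 1)) - b))
    (hlambar : ∀ k ≥ 1, lambar (k + 1) =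
      lam k + (γ * t (k + 1)) • (A (u (k + 1)) + B (v k) - b))
    -- saddle point
    (xs : EuclideanSpace ℝ (Fin m)) (ys : EuclideanSpace ℝ (Fin n))
    (lams : EuclideanSpace ℝ (Fin p))
    (hsaddle : ∀ xx yy ll,
      Lagr f1 f2 g1 g2 A B b xs ys ll ≤ Lagr f1 f2 g1 g2 A B b xs ys lams ∧
      Lagr f1 f2 g1 g2 A B b xs ys lams ≤ Lagr f1 f2 g1 g2 A B b xx yy lams) :
    -- conclusion
    let E1 : ℝ :=
      t 1 ^ 2 * (Lagr f1 f2 g1 g2 A B b (x 1) (y 1) lams -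
        Lagr f1 f2 g1 g2 A B b xs ys lams) +
      1 / (2 * α) * ‖x 1 - xs‖ ^ 2 + t 1 ^ 2 / (2 * β) * ‖y 1 - ys‖ ^ 2 +
      1 / (2 * γ) * ‖lam 1 - lams‖ ^ 2
    let C1 : ℝ :=
      3 * t 1 ^ 2 * ‖A (x 1) + B (y 1) - b‖ +
        (2 * ‖lam 1 - lams‖ +
          2 * Real.sqrt (2 * γ * E1 + γ ^ 2 * t 2 ^ 2 * ‖B (y 1 - ys)‖ ^ 2)) / γ
    ∀ k ≥ 1,
      Lagr f1 f2 g1 g2 A B b (x k) (y k) lams - Lagr f1 f2 g1 g2 A B b xs ys lams ≤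
        (E1 + γ * t 2 ^ 2 / 2 * ‖B (y 1 - ys)‖ ^ 2) / t k ^ 2 ∧
      ‖A (x k) + B (y k) - b‖ ≤ C1 / t k ^ 2 ∧
      |f1 (x k) + f2 (x k) + g1 (y k) + g2 (y k) -
          (f1 xs + f2 xs + g1 ys + g2 ys)| ≤
        (E1 + γ * t 2 ^ 2 / 2 * ‖B (y 1 - ys)‖ ^ 2 + C1 * ‖lams‖) / t k ^ 2 := by
  intro E1 C1 k hk
  set Ls := Lagr f1 f2 g1 g2 A B b xs ys lams with hLs
  set R : ℝ := E1 + γ * t 2 ^ 2 / 2 * ‖B (y 1 - ys)‖ ^ 2 with hR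
  have hLf2pos : 0 < Lf2 := hLf2.lt_of_ne fun h => by
    rw [← h, div_zero] at hαle; linarith
  have hLg2pos : 0 < Lg2 := hLg2.lt_of_ne fun h => by
    rw [← h, div_zero] at hβle; linarith
  have hαL : α * Lf2 ≤ 1 := (le_div_iff₀ hLf2pos).1 hαle
  have hβL : β * Lg2 ≤ t 1 ^ 2 := (le_div_iff₀ hLg2pos).1 hβle
  have htpos : ∀ k ≥ 1, 0 < t k := fun k hk => by linarith [ht1 k hk]
  have htne : ∀ k ≥ 1, t k ≠ 0 := fun k hk => (htpos k hk).ne'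
  have hfeas : A xs + B ys - b = 0 :=
    feasible_of_forall_Lagr_le fun l => (hsaddle xs ys l).1
  have hgrowth := Lagr_quadratic_growth hf1conv hf2conv hg1sc hg2conv
    fun x y => (hsaddle x y lams).2
  have hX : ∀ k ≥ 1, t (k + 1) • x (k + 1) = u (k + 1) + (t (k + 1) - 1) • x k :=
    fun k hk => smul_eq_of_eq_average (htne _ (by omega)) (hxupd k hk)
  have hY : ∀ k ≥ 1, t (k + 1) • y (k + 1) = v (k + 1) + (t (k + 1) - 1) • y k :=
    fun k hk => smul_eq_of_eq_average (htne _ (by omega)) (hyupd k hk)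
  have hstep : ∀ k ≥ 1,
      t (k + 1) ^ 2 * (2 * β * (Lagr f1 f2 g1 g2 A B b (x (k + 1)) (y (k + 1)) lams - Ls))
        + (β / α * ‖u (k + 1) - xs‖ ^ 2 + β / γ * ‖lam (k + 1) - lams‖ ^ 2)
        + (t (k + 1) ^ 2 + β * μ * t (k + 1)) * ‖v (k + 1) - ys‖ ^ 2
        + t (k + 1) ^ 2 * (β * γ * ‖B (v (k + 1) - ys)‖ ^ 2)
        + β * μ * (t (k + 1) - 1) * ‖(v (k + 1) - ys) - (y k - ys)‖ ^ 2
        + (t (k + 1) ^ 2 - t 1 ^ 2) * ‖(v (k + 1) - ys) - (v k - ys)‖ ^ 2 ≤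
      (t (k + 1) ^ 2 - t (k + 1)) * (2 * β * (Lagr f1 f2 g1 g2 A B b (x k) (y k) lams - Ls))
        + (β / α * ‖u k - xs‖ ^ 2 + β / γ * ‖lam k - lams‖ ^ 2)
        + t (k + 1) ^ 2 * ‖v k - ys‖ ^ 2
        + t (k + 1) ^ 2 * (β * γ * ‖B (v k - ys)‖ ^ 2) := by
    intro k hk
    have hT : 1 ≤ t (k + 1) := ht1 _ (by omega)
    have hf := primal_block_bound (z := xs) hT hα hαL (hξ k hk)
      (hf2conv.add_inner_gradient_le (hf2grad (xbar k)))
      (le_add_inner_of_lipschitz_gradient hf2grad hf2lip (xbar k) _) (hX k hk)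
      (smul_extrapolation_eq htne hx0 hu1 hxbar hX hk) (hu k hk)
    have hg := strongly_convex_block_bound (z := ys) hT hβ
      (strongConvexOn_subgradient hg1sc (hζ k hk))
      (hg2conv.add_inner_gradient_le (hg2grad (ybar k)))
      (le_add_inner_of_lipschitz_gradient hg2grad hg2lip (ybar k) _) (hY k hk)
      (smul_extrapolation_eq htne hy0 hv1 hybar hY hk) (hv k hk)
    have hd := dual_block_bound (l := lam k) (ls := lams) (a := A (u (k + 1) - xs))
      (bn := B (v (k + 1) - ys)) (bo := B (v k - ys)) (γ := γ) (T := t (k + 1))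
    have hresid : ∀ w, A (u (k + 1) - xs) + B (w - ys) = A (u (k + 1)) + B w - b := fun w => by
      rw [map_sub, map_sub, ← sub_zero (A (u (k + 1)) + B w - b), ← hfeas]; abel
    have hL := Lagr_step_eq (f1 := f1) (f2 := f2) (g1 := g1) (g2 := g2) (lams := lams) hfeas
      (hX k hk) (hY k hk)
    rw [ContinuousLinearMap.adjoint_inner_left] at hf hg
    rw [hresid (v k), hresid (v (k + 1)), ← hlam k hk, ← hlambar k hk,
      ← hresid (v (k + 1))] at hd
    have hf' := mul_le_mul_of_nonneg_left hf (div_pos hβ hα).le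
    have hd' := mul_le_mul_of_nonneg_left hd (div_pos hβ hγ).le
    have hα1 : β / α * α = β := div_mul_cancel₀ _ hα.ne'
    have hγ1 : β / γ * γ = β := div_mul_cancel₀ _ hγ.ne'
    have hβL' := mul_le_mul_of_nonneg_right hβL (sq_nonneg ‖v (k + 1) - v k‖)
    rw [sub_sub_sub_cancel_right, sub_sub_sub_cancel_right]
    have hf'' : 2 * β * (t (k + 1) ^ 2 * (f1 (x (k + 1)) + f2 (x (k + 1)))
        - (t (k + 1) ^ 2 - t (k + 1)) * (f1 (x k) + f2 (x k)) - t (k + 1) * (f1 xs + f2 xs)) ≤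
        β / α * (‖u k - xs‖ ^ 2 - ‖u (k + 1) - xs‖ ^ 2)
          - 2 * β * t (k + 1) * ⟪lambar (k + 1), A (u (k + 1) - xs)⟫ := by
      refine le_of_eq_of_le ?_ (hf'.trans (le_of_eq ?_))
      · linear_combination -2 * (t (k + 1) ^ 2 * (f1 (x (k + 1)) + f2 (x (k + 1)))
          - (t (k + 1) ^ 2 - t (k + 1)) * (f1 (x k) + f2 (x k)) - t (k + 1) * (f1 xs + f2 xs)) * hα1
      · linear_combination -2 * t (k + 1) * ⟪lambar (k + 1), A (u (k + 1) - xs)⟫ * hα1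
    have hd'' : 2 * β * t (k + 1) * (⟪lams, A (u (k + 1) - xs) + B (v (k + 1) - ys)⟫
          - ⟪lambar (k + 1), A (u (k + 1) - xs)⟫ - ⟪lam (k + 1), B (v (k + 1) - ys)⟫) ≤
        β / γ * (‖lam k - lams‖ ^ 2 - ‖lam (k + 1) - lams‖ ^ 2)
          + t (k + 1) ^ 2 * (β * γ * ‖B (v k - ys)‖ ^ 2)
          - t (k + 1) ^ 2 * (β * γ * ‖B (v (k + 1) - ys)‖ ^ 2) := by
      refine le_of_eq_of_le ?_ (hd'.trans (le_of_eq ?_))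
      · linear_combination -2 * t (k + 1) * (⟪lams, A (u (k + 1) - xs) + B (v (k + 1) - ys)⟫
          - ⟪lambar (k + 1), A (u (k + 1) - xs)⟫ - ⟪lam (k + 1), B (v (k + 1) - ys)⟫) * hγ1
      · linear_combination γ * t (k + 1) ^ 2 *
          (‖B (v k - ys)‖ ^ 2 - ‖B (v (k + 1) - ys)‖ ^ 2) * hγ1
    have hL' := congrArg (fun r => 2 * β * r) hL
    linarith
  have henergy : ∀ k ≥ 1, t k ^ 2 * (Lagr f1 f2 g1 g2 A B b (x k) (y k) lams - Ls)
      + 1 / (2 * γ) * ‖lam k - lams‖ ^ 2 ≤ R := by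
    intro k hk
    have h := energy_le (t := t)
      (δ := fun k => 2 * β * (Lagr f1 f2 g1 g2 A B b (x k) (y k) lams - Ls))
      (Q := fun k => β / α * ‖u k - xs‖ ^ 2 + β / γ * ‖lam k - lams‖ ^ 2)
      (N := fun k => β * γ * ‖B (v k - ys)‖ ^ 2) (V := fun k => v k - ys)
      (Y := fun k => y k - ys) (m := β * μ) (κ := β * γ * ‖B‖ ^ 2) (by positivity) (by positivity)
      ht1 htmono htrec htrec2 (by simp only [hv1])
      (fun k hk => by
        simp only [smul_sub, hY k hk]; module)
      (fun k hk => by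
        have := mul_le_mul_of_nonneg_left (hgrowth (x k) (y k)) (by linarith : 0 ≤ 2 * β)
        linarith)
      (fun k => by positivity)
      (fun k => by
        have h1 := pow_le_pow_left₀ (norm_nonneg _) (B.le_opNorm (v k - ys)) 2
        have h2 := mul_le_mul_of_nonneg_left h1 (mul_pos hβ hγ).le
        rw [mul_pow, ← mul_assoc] at h2
        exact h2)
      hstep hk
    simp only [hu1, hv1] at h
    have h1 : 0 ≤ β / α * ‖u k - xs‖ ^ 2 := by positivity
    have e1 : 2 * β * (t k ^ 2 * (Lagr f1 f2 g1 g2 A B b (x k) (y k) lams - Ls)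
        + 1 / (2 * γ) * ‖lam k - lams‖ ^ 2) =
        t k ^ 2 * (2 * β * (Lagr f1 f2 g1 g2 A B b (x k) (y k) lams - Ls))
          + β / γ * ‖lam k - lams‖ ^ 2 := by field_simp
    have e2 : 2 * β * R = t 1 ^ 2 * (2 * β * (Lagr f1 f2 g1 g2 A B b (x 1) (y 1) lams - Ls))
        + (β / α * ‖x 1 - xs‖ ^ 2 + β / γ * ‖lam 1 - lams‖ ^ 2) + t 1 ^ 2 * ‖y 1 - ys‖ ^ 2
        + t 2 ^ 2 * (β * γ * ‖B (y 1 - ys)‖ ^ 2) := by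
      simp only [hR, E1]; field_simp; ring
    refine le_of_mul_le_mul_left ?_ (by linarith : 0 < 2 * β)
    rw [e1, e2]
    linarith
  have hgap0 : ∀ k, 0 ≤ Lagr f1 f2 g1 g2 A B b (x k) (y k) lams - Ls :=
    fun k => sub_nonneg.2 (hsaddle (x k) (y k) lams).2
  have hgap : Lagr f1 f2 g1 g2 A B b (x k) (y k) lams - Ls ≤ R / t k ^ 2 := by
    rw [le_div_iff₀ (pow_pos (htpos k hk) 2)]
    have : 0 ≤ 1 / (2 * γ) * ‖lam k - lams‖ ^ 2 := by positivity
    linarith [henergy k hk]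
  have hres : ‖A (x k) + B (y k) - b‖ ≤ C1 / t k ^ 2 := by
    have hdual : ∀ j ≥ 1, ‖(1 / γ) • (lam j - lams)‖ ≤ √(2 * γ * R) / γ := by
      intro j hj
      rw [norm_smul, Real.norm_of_nonneg (by positivity), one_div_mul_eq_div]
      gcongr
      apply Real.le_sqrt_of_sq_le
      have h1 := henergy j hj
      have h2 : 0 ≤ t j ^ 2 * (Lagr f1 f2 g1 g2 A B b (x j) (y j) lams - Ls) :=
        mul_nonneg (sq_nonneg _) (hgap0 j)
      have h3 : 1 / (2 * γ) * ‖lam j - lams‖ ^ 2 ≤ R := by linarith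
      rwa [one_div_mul_eq_div, div_le_iff₀' (by linarith)] at h3
    have h := norm_le_of_weighted_recursion
      (a := fun j => t j ^ 2 • (A (x j) + B (y j) - b)) (l := fun j => (1 / γ) • (lam j - lams))
      (θ := fun j => (t (j + 1) ^ 2 - t (j + 1)) / t j ^ 2)
      (fun j hj => div_nonneg (by nlinarith [ht1 (j + 1) (by omega)]) (sq_nonneg _))
      (fun j hj => by
        rw [div_le_one (pow_pos (htpos j hj) 2)]; linarith [htrec j hj])
      (fun j hj => by
        have hr := residual_recursion (A := A) (B := B) (b := b) (hX j hj) (hY j hj)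
        have e1 : lam (j + 1) - lams = lam j - lams
            + (γ * t (j + 1)) • (A (u (j + 1)) + B (v (j + 1)) - b) := by rw [hlam j hj]; abel
        have e2 : 1 / γ * (γ * t (j + 1)) = t (j + 1) := by field_simp
        rw [e1, smul_add, add_sub_cancel_left, smul_smul, smul_smul, e2,
          div_mul_cancel₀ _ (pow_ne_zero 2 (htne j hj)), pow_two (t (j + 1)), mul_smul, hr]
        module)
      hdual hk
    have e : 2 * γ * R = 2 * γ * E1 + γ ^ 2 * t 2 ^ 2 * ‖B (y 1 - ys)‖ ^ 2 := by
      rw [hR]; ring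
    rw [norm_smul, norm_smul, norm_smul, Real.norm_of_nonneg (sq_nonneg _),
      Real.norm_of_nonneg (sq_nonneg _), Real.norm_of_nonneg (by positivity : 0 ≤ 1 / γ), e] at h
    rw [le_div_iff₀ (pow_pos (htpos k hk) 2), mul_comm]
    refine h.trans ?_
    simp only [C1, add_div, mul_div_assoc]
    have h1 : 0 ≤ t 1 ^ 2 * ‖A (x 1) + B (y 1) - b‖ := by positivity
    have h2 : 0 ≤ ‖lam 1 - lams‖ / γ := by positivity
    rw [one_div_mul_eq_div]
    linarith
  refine ⟨hgap, hres, ?_⟩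
  have hdecomp : f1 (x k) + f2 (x k) + g1 (y k) + g2 (y k) - (f1 xs + f2 xs + g1 ys + g2 ys) =
      (Lagr f1 f2 g1 g2 A B b (x k) (y k) lams - Ls) - ⟪lams, A (x k) + B (y k) - b⟫ := by
    simp only [hLs, Lagr, hfeas, inner_zero_right]; ring
  rw [hdecomp, add_div]
  refine (abs_sub _ _).trans (add_le_add ?_ ?_)
  · rwa [abs_of_nonneg (hgap0 k)]
  · refine (abs_real_inner_le_norm _ _).trans ?_
    rw [mul_comm, mul_div_right_comm]
    exact mul_le_mul_of_nonneg_right hres (norm_nonneg _)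
end
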